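/- arXiv:1308.3895 — 3 statements merged into one kernel-verified Lean document; each statement's English description precedes it below -/
import Mathlib

section
/- Failure of the 1D collapsing estimate without derivative gain (optimality part of Theorem 1.3): For every T > 0 there is NO constant C such that ( ∫_0^T ‖ B_{1,2} U^{(2)}(τ) φ ‖_{L²(ℝ×ℝ)}² dτ )^{1/2} ≤ C ‖ φ ‖_{L²(ℝ²×ℝ²)} holds for all Schwartz functions φ on ℝ² × ℝ². -/
open MeasureTheory Complex
open scoped ENNReal NNReal BigOperators

noncomputable section

/-- Euclidean dot product on `Fin k → ℝ`. -/
def dotR {k : ℕ} (a b : Fin k → ℝ) : ℝ := ∑ i, a i * b i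

/-- Japanese bracket `⟨x⟩ = √(1+x²)`. -/
def jap (x : ℝ) : ℝ := Real.sqrt (1 + x ^ 2)

/-- Fourier transform with the convention
`φ̂(ξ,ξ') = ∫ e^{-i(y·ξ + y'·ξ')} φ(y,y') dy dy'`. -/
def ftK (k : ℕ) (φ : (Fin k → ℝ) × (Fin k → ℝ) → ℂ) :
    (Fin k → ℝ) × (Fin k → ℝ) → ℂ :=
  fun ξ => ∫ y : (Fin k → ℝ) × (Fin k → ℝ),
    Complex.exp (-Complex.I * ((dotR y.1 ξ.1 + dotR y.2 ξ.2 : ℝ) : ℂ)) * φ y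

/-- Free evolution `U^{(k)}(τ)`, defined via Fourier inversion: it is the function whose
Fourier transform is `e^{-iτ(|ξ|² - |ξ'|²)} φ̂(ξ,ξ')`. -/
def freeEvol (k : ℕ) (τ : ℝ) (φ : (Fin k → ℝ) × (Fin k → ℝ) → ℂ) :
    (Fin k → ℝ) × (Fin k → ℝ) → ℂ :=
  fun y => (((2 * Real.pi) ^ (2 * k))⁻¹ : ℝ) •
    ∫ ξ : (Fin k → ℝ) × (Fin k → ℝ),
      Complex.exp (Complex.I * ((dotR y.1 ξ.1 + dotR y.2 ξ.2
        - τ * ((∑ i, ξ.1 i ^ 2) - (∑ i, ξ.2 i ^ 2)) : ℝ) : ℂ)) * ftK k φ ξ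

/-- The Fourier multiplier `R_ε^{(k)}` with symbol `∏_j ⟨ξ_j⟩^ε ⟨ξ'_j⟩^ε`. -/
def Rop (ε : ℝ) (k : ℕ) (f : (Fin k → ℝ) × (Fin k → ℝ) → ℂ) :
    (Fin k → ℝ) × (Fin k → ℝ) → ℂ :=
  fun y => (((2 * Real.pi) ^ (2 * k))⁻¹ : ℝ) •
    ∫ ξ : (Fin k → ℝ) × (Fin k → ℝ),
      Complex.exp (Complex.I * ((dotR y.1 ξ.1 + dotR y.2 ξ.2 : ℝ) : ℂ)) *
        (((∏ j, jap (ξ.1 j) ^ ε * jap (ξ.2 j) ^ ε : ℝ) : ℂ) * ftK k f ξ)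

/-- The collision operator `B_{j,k+1}`. -/
def collision (k : ℕ) (j : Fin k) (u : (Fin (k+1) → ℝ) × (Fin (k+1) → ℝ) → ℂ) :
    (Fin k → ℝ) × (Fin k → ℝ) → ℂ :=
  fun y => u (Fin.snoc y.1 (y.1 j), Fin.snoc y.2 (y.1 j))
         - u (Fin.snoc y.1 (y.2 j), Fin.snoc y.2 (y.2 j))

/-- The `L²` norm, valued in `[0,∞]`. -/
def L2E (k : ℕ) (f : (Fin k → ℝ) × (Fin k → ℝ) → ℂ) : ℝ≥0∞ :=
  (∫⁻ y : (Fin k → ℝ) × (Fin k → ℝ), (‖f y‖₊ : ℝ≥0∞) ^ 2) ^ (1/2 : ℝ)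

open scoped ContDiff FourierTransform

lemma L2E_sq (k : ℕ) (g : (Fin k → ℝ) × (Fin k → ℝ) → ℂ) :
    L2E k g ^ 2 = ∫⁻ y, (‖g y‖₊ : ℝ≥0∞) ^ 2 := by
  rw [L2E, ← ENNReal.rpow_natCast, ← ENNReal.rpow_mul]; norm_num

lemma integral_comp_two_pi_inv_smul {V : Type*} [NormedAddCommGroup V] [InnerProductSpace ℝ V]
    [FiniteDimensional ℝ V] [MeasurableSpace V] [BorelSpace V] (hV : Module.finrank ℝ V = 4)
    {E : Type*} [NormedAddCommGroup E] [NormedSpace ℝ E] (g : V → E) :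
    ∫ v, g ((2 * Real.pi)⁻¹ • v) = ((2 * Real.pi) ^ 4 : ℝ) • ∫ v, g v := by
  rw [Measure.integral_comp_inv_smul, hV, abs_of_pos (by positivity)]

/-- Transport of Fourier inversion and Plancherel along a measure preserving linear isomorphism
which turns the inner product into the dot product. -/
lemma exists_ftK_eq_of_equiv {V : Type*} [NormedAddCommGroup V] [InnerProductSpace ℝ V]
    [FiniteDimensional ℝ V] [MeasurableSpace V] [BorelSpace V]
    (L : V ≃L[ℝ] (Fin 2 → ℝ) × (Fin 2 → ℝ)) (hL : MeasurePreserving L)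
    (hdot : ∀ v w, dotR (L v).1 (L w).1 + dotR (L v).2 (L w).2 = inner ℝ v w)
    (f : (Fin 2 → ℝ) × (Fin 2 → ℝ) → ℝ) (hf : ContDiff ℝ ∞ f)
    (hc : HasCompactSupport f) :
    ∃ φ : SchwartzMap ((Fin 2 → ℝ) × (Fin 2 → ℝ)) ℂ,
      (∀ ξ, ftK 2 φ ξ = (((2 * Real.pi) ^ 4 : ℝ) : ℂ) * (f ξ : ℂ)) ∧
      L2E 2 φ ^ 2 = ENNReal.ofReal ((2 * Real.pi) ^ 4 * ∫ ξ, f ξ ^ 2) := by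
  have hLe : MeasurableEmbedding L := L.toHomeomorph.measurableEmbedding
  have hV : Module.finrank ℝ V = 4 := by
    rw [L.toLinearEquiv.finrank_eq]; simp
  have hfC : ContDiff ℝ ∞ (fun ξ => (f ξ : ℂ)) := Complex.ofRealCLM.contDiff.comp hf
  have hcC : HasCompactSupport (fun ξ => (f ξ : ℂ)) := hc.comp_left Complex.ofReal_zero
  obtain ⟨G, hG⟩ : ∃ G : SchwartzMap V ℂ, ∀ v, G v = (f (L v) : ℂ) :=
    ⟨SchwartzMap.compCLMOfContinuousLinearEquiv ℂ L (hcC.toSchwartzMap hfC),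
      fun v => rfl⟩
  obtain ⟨H, hH⟩ : ∃ H : SchwartzMap V ℂ, 𝓕 H = G :=
    ⟨𝓕⁻ G, FourierTransform.fourier_fourierInv_eq G⟩
  have h2pi : (2 * Real.pi : ℝ) ≠ 0 := by positivity
  obtain ⟨φ, hφ⟩ : ∃ φ : SchwartzMap ((Fin 2 → ℝ) × (Fin 2 → ℝ)) ℂ,
      ∀ v, φ (L v) = H ((2 * Real.pi)⁻¹ • v) := by
    refine ⟨SchwartzMap.compCLMOfContinuousLinearEquiv ℂ (L.symm.trans
      (ContinuousLinearEquiv.smulLeft (Units.mk0 (2 * Real.pi : ℝ) h2pi)⁻¹)) H, fun v => ?_⟩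
    rw [SchwartzMap.compCLMOfContinuousLinearEquiv_apply, Function.comp_apply,
      ContinuousLinearEquiv.trans_apply, ContinuousLinearEquiv.symm_apply_apply]
    rfl
  refine ⟨φ, ?_, ?_⟩
  · intro ξ
    obtain ⟨w, rfl⟩ := L.surjective ξ
    rw [ftK, ← hL.integral_comp hLe]
    let g : V → ℂ := fun u => Complex.exp (↑(-2 * Real.pi * inner ℝ u w) * Complex.I) * H u
    have key : ∀ v : V, Complex.exp (-Complex.I *
        ((dotR (L v).1 (L w).1 + dotR (L v).2 (L w).2 : ℝ) : ℂ)) * φ (L v)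
        = g ((2 * Real.pi)⁻¹ • v) := by
      intro v
      rw [hdot, hφ]
      simp only [g, real_inner_smul_left]
      congr 2
      push_cast
      have : (Real.pi : ℂ) ≠ 0 := by exact_mod_cast Real.pi_ne_zero
      field_simp
    refine (integral_congr_ae (.of_forall key)).trans
      ((integral_comp_two_pi_inv_smul hV g).trans ?_)
    have h1 : (𝓕 H) w = G w := by rw [hH]
    rw [SchwartzMap.fourier_coe, Real.fourier_eq'] at h1
    simp only [smul_eq_mul] at h1
    change _ • ∫ u, Complex.exp (↑(-2 * Real.pi * inner ℝ u w) * Complex.I) * H u = _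
    rw [h1, hG]
    simp
  · rw [L2E_sq, ← hL.lintegral_comp_emb hLe]
    have e2 : ∀ v, (‖φ (L v)‖₊ : ℝ≥0∞) ^ 2
        = ENNReal.ofReal ((fun u => ‖H u‖ ^ 2) ((2 * Real.pi)⁻¹ • v)) := by
      intro v
      rw [hφ, ENNReal.ofReal_pow (norm_nonneg _), ofReal_norm, enorm_eq_nnnorm]
    have hint : Integrable (fun u : V => ‖H u‖ ^ 2) := by
      have := (H.memLp 2 (volume : Measure V)).integrable_norm_pow (by norm_num)
      simpa using this
    rw [lintegral_congr e2, ← ofReal_integral_eq_lintegral_ofReal]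
    · rw [integral_comp_two_pi_inv_smul hV fun u => ‖H u‖ ^ 2, smul_eq_mul]
      have h3 := SchwartzMap.integral_norm_sq_fourier H
      rw [hH] at h3
      rw [← h3, ← hL.integral_comp hLe]
      simp [hG]
    · exact hint.comp_smul (inv_ne_zero h2pi)
    · exact Filter.Eventually.of_forall fun v => by positivity

/-- The Euclidean model of the phase space `ℝ² × ℝ²`. -/
abbrev PhaseE : Type := WithLp 2 (EuclideanSpace ℝ (Fin 2) × EuclideanSpace ℝ (Fin 2))

/-- The identity map from the Euclidean model to the sup-norm model. -/
def phaseEquiv : PhaseE ≃L[ℝ] (Fin 2 → ℝ) × (Fin 2 → ℝ) :=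
  (WithLp.prodContinuousLinearEquiv 2 ℝ _ _).trans
    ((EuclideanSpace.equiv (Fin 2) ℝ).prodCongr (EuclideanSpace.equiv (Fin 2) ℝ))

lemma measurePreserving_phaseEquiv : MeasurePreserving phaseEquiv :=
  ((PiLp.volume_preserving_ofLp (Fin 2)).prod (PiLp.volume_preserving_ofLp (Fin 2))).comp
    (WithLp.volume_preserving_ofLp (EuclideanSpace ℝ (Fin 2)) (EuclideanSpace ℝ (Fin 2)))

lemma dotR_phaseEquiv (v w : PhaseE) :
    dotR (phaseEquiv v).1 (phaseEquiv w).1 + dotR (phaseEquiv v).2 (phaseEquiv w).2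
      = inner ℝ v w := by
  rw [WithLp.prod_inner_apply, PiLp.inner_apply, PiLp.inner_apply, dotR, dotR]
  congr 1 <;> exact Finset.sum_congr rfl fun i _ => mul_comm _ _

lemma exists_ftK_eq (f : (Fin 2 → ℝ) × (Fin 2 → ℝ) → ℝ) (hf : ContDiff ℝ ∞ f)
    (hc : HasCompactSupport f) :
    ∃ φ : SchwartzMap ((Fin 2 → ℝ) × (Fin 2 → ℝ)) ℂ,
      (∀ ξ, ftK 2 φ ξ = (((2 * Real.pi) ^ 4 : ℝ) : ℂ) * (f ξ : ℂ)) ∧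
      L2E 2 φ ^ 2 = ENNReal.ofReal ((2 * Real.pi) ^ 4 * ∫ ξ, f ξ ^ 2) :=
  exists_ftK_eq_of_equiv phaseEquiv measurePreserving_phaseEquiv dotR_phaseEquiv f hf hc

/-- The plane wave on `ℝ × ℝ` with frequency `(p, q)`. -/
def planeWave (p q : ℝ) (y : (Fin 1 → ℝ) × (Fin 1 → ℝ)) : ℂ :=
  Complex.exp (Complex.I * ((y.1 0 * p + y.2 0 * q : ℝ) : ℂ))

/-- The standard Gaussian weight on `ℝ × ℝ`. -/
def gaussWeight (y : (Fin 1 → ℝ) × (Fin 1 → ℝ)) : ℝ :=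
  Real.exp (-(1 / 2) * y.1 0 ^ 2) * Real.exp (-(1 / 2) * y.2 0 ^ 2)

/-- The kernel of the composition of `B_{1,2}` with the inverse Fourier transform. -/
def collisionKernel (y : (Fin 1 → ℝ) × (Fin 1 → ℝ)) (ξ : (Fin 2 → ℝ) × (Fin 2 → ℝ)) : ℂ :=
  planeWave (ξ.1 0 + ξ.1 1 + ξ.2 1) (ξ.2 0) y - planeWave (ξ.1 0) (ξ.1 1 + ξ.2 0 + ξ.2 1) y

/-- The dispersion relation `|ξ|² - |ξ'|²`. -/
def dispersion (ξ : (Fin 2 → ℝ) × (Fin 2 → ℝ)) : ℝ := (∑ i, ξ.1 i ^ 2) - ∑ i, ξ.2 i ^ 2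

lemma norm_planeWave (p q : ℝ) (y : (Fin 1 → ℝ) × (Fin 1 → ℝ)) : ‖planeWave p q y‖ = 1 := by
  rw [planeWave, mul_comm, Complex.norm_exp_ofReal_mul_I]

lemma norm_collisionKernel_le (y : (Fin 1 → ℝ) × (Fin 1 → ℝ))
    (ξ : (Fin 2 → ℝ) × (Fin 2 → ℝ)) : ‖collisionKernel y ξ‖ ≤ 2 := by
  refine (norm_sub_le _ _).trans ?_
  rw [norm_planeWave, norm_planeWave]; norm_num

lemma continuous_collisionKernel : Continuous (Function.uncurry collisionKernel) := by
  unfold collisionKernel planeWave Function.uncurry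
  fun_prop

lemma measurePreserving_funUnique_prod :
    MeasurePreserving (Prod.map (MeasurableEquiv.funUnique (Fin 1) ℝ)
      (MeasurableEquiv.funUnique (Fin 1) ℝ)) :=
  (volume_preserving_funUnique (Fin 1) ℝ).prod (volume_preserving_funUnique (Fin 1) ℝ)

lemma measurableEmbedding_funUnique_prod :
    MeasurableEmbedding (Prod.map (MeasurableEquiv.funUnique (Fin 1) ℝ)
      (MeasurableEquiv.funUnique (Fin 1) ℝ)) :=
  ((MeasurableEquiv.funUnique (Fin 1) ℝ).prodCongr
    (MeasurableEquiv.funUnique (Fin 1) ℝ)).measurableEmbedding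

lemma continuous_gaussWeight : Continuous gaussWeight := by
  unfold gaussWeight; fun_prop

lemma gaussWeight_pos (y : (Fin 1 → ℝ) × (Fin 1 → ℝ)) : 0 < gaussWeight y := by
  unfold gaussWeight; positivity

lemma gaussWeight_le_one (y : (Fin 1 → ℝ) × (Fin 1 → ℝ)) : gaussWeight y ≤ 1 := by
  unfold gaussWeight
  rw [← Real.exp_add]
  exact Real.exp_le_one_iff.2 (by nlinarith [sq_nonneg (y.1 0), sq_nonneg (y.2 0)])

lemma integrable_gaussWeight : Integrable gaussWeight := by
  have h := (integrable_exp_neg_mul_sq (b := 1 / 2) (by norm_num)).mul_prod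
    (integrable_exp_neg_mul_sq (b := 1 / 2) (by norm_num))
  exact (measurePreserving_funUnique_prod.integrable_comp_emb
    measurableEmbedding_funUnique_prod).2 h

lemma integral_exp_mul_gaussian (t : ℝ) :
    ∫ x : ℝ, Complex.exp (Complex.I * ((x * t : ℝ) : ℂ)) * (Real.exp (-(1 / 2) * x ^ 2) : ℂ)
      = ((Real.sqrt (2 * Real.pi) * Real.exp (-t ^ 2 / 2) : ℝ) : ℂ) := by
  have h := fourierIntegral_gaussian (b := 1 / 2) (by norm_num) t
  have e : ∀ x : ℝ, Complex.exp (Complex.I * ((x * t : ℝ) : ℂ)) *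
      (Real.exp (-(1 / 2) * x ^ 2) : ℂ)
      = Complex.exp (Complex.I * t * x) * Complex.exp (-(1 / 2) * (x : ℂ) ^ 2) := by
    intro x
    push_cast
    congr 2
    ring
  rw [integral_congr_ae (.of_forall e), h]
  have hs : ((Real.pi : ℂ) / (1 / 2)) ^ (1 / 2 : ℂ) = ((Real.sqrt (2 * Real.pi) : ℝ) : ℂ) := by
    rw [Real.sqrt_eq_rpow, Complex.ofReal_cpow (by positivity)]
    push_cast
    congr 1
    ring
  rw [hs]
  push_cast
  congr 2
  ring

lemma integral_gaussWeight_mul_planeWave (p q : ℝ) :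
    ∫ y, (gaussWeight y : ℂ) * planeWave p q y
      = ((2 * Real.pi * Real.exp (-(p ^ 2 + q ^ 2) / 2) : ℝ) : ℂ) := by
  let F : ℝ × ℝ → ℂ := fun x =>
    (Complex.exp (Complex.I * ((x.1 * p : ℝ) : ℂ)) * (Real.exp (-(1 / 2) * x.1 ^ 2) : ℂ)) *
    (Complex.exp (Complex.I * ((x.2 * q : ℝ) : ℂ)) * (Real.exp (-(1 / 2) * x.2 ^ 2) : ℂ))
  have e : ∀ y, (gaussWeight y : ℂ) * planeWave p q y
      = F (Prod.map (MeasurableEquiv.funUnique (Fin 1) ℝ)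
        (MeasurableEquiv.funUnique (Fin 1) ℝ) y) := by
    intro y
    have : planeWave p q y = Complex.exp (Complex.I * ((y.1 0 * p : ℝ) : ℂ)) *
        Complex.exp (Complex.I * ((y.2 0 * q : ℝ) : ℂ)) := by
      rw [planeWave, ← Complex.exp_add]; push_cast; congr 1; ring
    rw [this, gaussWeight]
    simp only [F, Prod.map, MeasurableEquiv.funUnique_apply]
    push_cast
    simp only [Fin.default_eq_zero, Fin.isValue]
    ring
  rw [integral_congr_ae (.of_forall e),
    measurePreserving_funUnique_prod.integral_comp measurableEmbedding_funUnique_prod F]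
  have h := integral_prod_mul (μ := (volume : Measure ℝ)) (ν := (volume : Measure ℝ))
    (fun x : ℝ => Complex.exp (Complex.I * ((x * p : ℝ) : ℂ)) *
      (Real.exp (-(1 / 2) * x ^ 2) : ℂ))
    (fun x : ℝ => Complex.exp (Complex.I * ((x * q : ℝ) : ℂ)) *
      (Real.exp (-(1 / 2) * x ^ 2) : ℂ))
  rw [integral_exp_mul_gaussian, integral_exp_mul_gaussian, ← Complex.ofReal_mul] at h
  refine h.trans (congrArg _ ?_)
  have e2 : -(p ^ 2 + q ^ 2) / 2 = -p ^ 2 / 2 + -q ^ 2 / 2 := by ring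
  rw [e2, Real.exp_add]
  have := Real.mul_self_sqrt (show 0 ≤ 2 * Real.pi by positivity)
  linear_combination (Real.exp (-p ^ 2 / 2) * Real.exp (-q ^ 2 / 2)) * this

lemma integrable_gaussWeight_mul_planeWave (p q : ℝ) :
    Integrable fun y => (gaussWeight y : ℂ) * planeWave p q y := by
  refine integrable_gaussWeight.ofReal.mul_bdd (c := 1) ?_ ?_
  · exact (show Continuous (planeWave p q) by unfold planeWave; fun_prop).aestronglyMeasurable
  · exact .of_forall fun y => (norm_planeWave p q y).le

lemma integral_gaussWeight_mul_collisionKernel (ξ : (Fin 2 → ℝ) × (Fin 2 → ℝ)) :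
    ∫ y, (gaussWeight y : ℂ) * collisionKernel y ξ
      = ((2 * Real.pi * (Real.exp (-((ξ.1 0 + ξ.1 1 + ξ.2 1) ^ 2 + ξ.2 0 ^ 2) / 2)
        - Real.exp (-(ξ.1 0 ^ 2 + (ξ.1 1 + ξ.2 0 + ξ.2 1) ^ 2) / 2)) : ℝ) : ℂ) := by
  simp only [collisionKernel, mul_sub]
  rw [integral_sub (integrable_gaussWeight_mul_planeWave _ _)
    (integrable_gaussWeight_mul_planeWave _ _), integral_gaussWeight_mul_planeWave,
    integral_gaussWeight_mul_planeWave, ← Complex.ofReal_sub]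

lemma integrable_planeWave_mul {h : (Fin 2 → ℝ) × (Fin 2 → ℝ) → ℂ} (hh : Integrable h)
    (y : (Fin 1 → ℝ) × (Fin 1 → ℝ)) {P Q : (Fin 2 → ℝ) × (Fin 2 → ℝ) → ℝ}
    (hP : Continuous P) (hQ : Continuous Q) :
    Integrable fun ξ => planeWave (P ξ) (Q ξ) y * h ξ := by
  refine hh.bdd_mul (c := 1) ?_ ?_
  · exact (show Continuous fun ξ => planeWave (P ξ) (Q ξ) y by
      unfold planeWave; fun_prop).aestronglyMeasurable
  · exact .of_forall fun ξ => (norm_planeWave _ _ y).le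

/-- The function `y ↦ (B_{1,2} U^{(2)}(τ) φ)(y)` where `φ̂` is proportional to `f`. -/
def collisionEvol (f : (Fin 2 → ℝ) × (Fin 2 → ℝ) → ℝ) (τ : ℝ)
    (y : (Fin 1 → ℝ) × (Fin 1 → ℝ)) : ℂ :=
  ∫ ξ, collisionKernel y ξ *
    (Complex.exp (((-τ * dispersion ξ : ℝ) : ℂ) * Complex.I) * (f ξ : ℂ))

lemma continuous_exp_dispersion (τ : ℝ) :
    Continuous fun ξ => Complex.exp (((-τ * dispersion ξ : ℝ) : ℂ) * Complex.I) := by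
  unfold dispersion; fun_prop

lemma integrable_exp_dispersion_mul {f : (Fin 2 → ℝ) × (Fin 2 → ℝ) → ℝ} (hf : Integrable f)
    (τ : ℝ) :
    Integrable fun ξ => Complex.exp (((-τ * dispersion ξ : ℝ) : ℂ) * Complex.I) * (f ξ : ℂ) :=
  hf.ofReal.bdd_mul (c := 1) (continuous_exp_dispersion τ).aestronglyMeasurable
    (.of_forall fun _ => (Complex.norm_exp_ofReal_mul_I _).le)

/-- The free evolution, followed by the collision operator, in terms of the Fourier transform. -/
lemma collision_freeEvol_eq {f : (Fin 2 → ℝ) × (Fin 2 → ℝ) → ℝ} (hf : Integrable f)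
    {φ : (Fin 2 → ℝ) × (Fin 2 → ℝ) → ℂ}
    (hφ : ∀ ξ, ftK 2 φ ξ = (((2 * Real.pi) ^ 4 : ℝ) : ℂ) * (f ξ : ℂ)) (τ : ℝ)
    (y : (Fin 1 → ℝ) × (Fin 1 → ℝ)) :
    collision 1 0 (fun y => freeEvol 2 τ φ y) y = collisionEvol f τ y := by
  let h : (Fin 2 → ℝ) × (Fin 2 → ℝ) → ℂ := fun ξ =>
    Complex.exp (((-τ * dispersion ξ : ℝ) : ℂ) * Complex.I) * (f ξ : ℂ)
  have hh : Integrable h := integrable_exp_dispersion_mul hf τ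
  have key : ∀ (x : (Fin 2 → ℝ) × (Fin 2 → ℝ)) (P Q : (Fin 2 → ℝ) × (Fin 2 → ℝ) → ℝ),
      (∀ ξ, dotR x.1 ξ.1 + dotR x.2 ξ.2 = y.1 0 * P ξ + y.2 0 * Q ξ) →
      freeEvol 2 τ φ x = ∫ ξ, planeWave (P ξ) (Q ξ) y * h ξ := by
    intro x P Q hPQ
    have hpi : ((2 * Real.pi : ℝ) : ℂ) ≠ 0 := by
      exact_mod_cast (by positivity : (2 * Real.pi : ℝ) ≠ 0)
    rw [freeEvol, ← integral_smul]
    refine integral_congr_ae (.of_forall fun ξ => ?_)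
    simp only [h, planeWave]
    rw [hφ, hPQ, ← mul_assoc (Complex.exp _) (Complex.exp _), ← Complex.exp_add]
    have e : Complex.I * ((y.1 0 * P ξ + y.2 0 * Q ξ
        - τ * ((∑ i, ξ.1 i ^ 2) - (∑ i, ξ.2 i ^ 2)) : ℝ) : ℂ)
        = Complex.I * ((y.1 0 * P ξ + y.2 0 * Q ξ : ℝ) : ℂ)
          + ((-τ * dispersion ξ : ℝ) : ℂ) * Complex.I := by
      rw [dispersion]; push_cast; ring
    rw [e, Complex.real_smul]
    push_cast at hpi ⊢
    field_simp
  rw [collision,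
    key _ (fun ξ => ξ.1 0 + ξ.1 1 + ξ.2 1) (fun ξ => ξ.2 0) (fun ξ => by
      simp [dotR, Fin.sum_univ_two, Fin.snoc]; ring),
    key _ (fun ξ => ξ.1 0) (fun ξ => ξ.1 1 + ξ.2 0 + ξ.2 1) (fun ξ => by
      simp [dotR, Fin.sum_univ_two, Fin.snoc]; ring),
    ← integral_sub (integrable_planeWave_mul hh y (by fun_prop) (by fun_prop))
      (integrable_planeWave_mul hh y (by fun_prop) (by fun_prop))]
  simp only [← sub_mul]
  rfl

/-- The frequency `ξ₀ + ξ₁ + ξ'₁` of the first collision term. -/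
def sumFreq (ξ : (Fin 2 → ℝ) × (Fin 2 → ℝ)) : ℝ := ξ.1 0 + ξ.1 1 + ξ.2 1

/-- The product `(ξ₁ + ξ'₁) (ξ₀ + ξ'₁)`, i.e. the nontrivial part of the dispersion relation. -/
def crossFreq (ξ : (Fin 2 → ℝ) × (Fin 2 → ℝ)) : ℝ := (ξ.1 1 + ξ.2 1) * (ξ.1 0 + ξ.2 1)

lemma lintegral_comp_finTwoArrow (F : (ℝ × ℝ) × (ℝ × ℝ) → ℝ≥0∞) :
    ∫⁻ ξ : (Fin 2 → ℝ) × (Fin 2 → ℝ), F ((ξ.1 0, ξ.1 1), (ξ.2 0, ξ.2 1)) = ∫⁻ x, F x :=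
  ((volume_preserving_finTwoArrow ℝ).prod (volume_preserving_finTwoArrow ℝ)).lintegral_comp_emb
    (MeasurableEquiv.finTwoArrow.prodCongr MeasurableEquiv.finTwoArrow).measurableEmbedding F

lemma lintegral_comp_freq {k c : ℝ → ℝ≥0∞} (hk : Measurable k) (hc : Measurable c) :
    ∫⁻ z, ∫⁻ x, ∫⁻ y, k (x + y + z) * (k ((y + z) * (x + z)) * c (-(y + z)))
      = (∫⁻ x, k x) * ∫⁻ a, c a * ∫⁻ b, k (a * b) := by
  have h1 : ∀ z x, ∫⁻ y, k (x + y + z) * (k ((y + z) * (x + z)) * c (-(y + z)))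
      = ∫⁻ a, k (x - a) * (k (-a * (x + z)) * c a) := by
    intro z x
    rw [← lintegral_sub_left_eq_self _ (-z)]
    refine lintegral_congr fun a => ?_
    rw [show x + (-z - a) + z = x - a by ring, show -z - a + z = -a by ring, neg_neg]
  have h2 : ∀ z, ∫⁻ x, ∫⁻ a, k (x - a) * (k (-a * (x + z)) * c a)
      = ∫⁻ b, ∫⁻ a, k (-b - a - z) * (k (a * b) * c a) := by
    intro z
    rw [← lintegral_sub_left_eq_self _ (-z)]
    refine lintegral_congr fun b => lintegral_congr fun a => ?_
    rw [show -z - b - a = -b - a - z by ring, show -a * (-z - b + z) = a * b by ring]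
  simp only [h1, h2]
  rw [lintegral_lintegral_swap
    (Measurable.aemeasurable (by unfold Function.uncurry; fun_prop))]
  have h3 : ∀ b, ∫⁻ z, ∫⁻ a, k (-b - a - z) * (k (a * b) * c a)
      = ∫⁻ a, (∫⁻ x, k x) * (k (a * b) * c a) := by
    intro b
    rw [lintegral_lintegral_swap
      (Measurable.aemeasurable (by unfold Function.uncurry; fun_prop))]
    refine lintegral_congr fun a => ?_
    rw [lintegral_mul_const _ (by fun_prop), lintegral_sub_left_eq_self]
  simp only [h3]
  rw [lintegral_lintegral_swap
    (Measurable.aemeasurable (by unfold Function.uncurry; fun_prop)),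
    ← lintegral_const_mul _ (by fun_prop)]
  refine lintegral_congr fun a => ?_
  rw [lintegral_const_mul _ (by fun_prop), lintegral_mul_const _ (by fun_prop), mul_comm (c a)]

lemma lintegral_comp_mul_of_pos (k : ℝ → ℝ≥0∞) (hk : Measurable k) {a : ℝ} (ha : 0 < a) :
    ∫⁻ b, k (a * b) = ENNReal.ofReal a⁻¹ * ∫⁻ x, k x := by
  have h := lintegral_map (μ := volume) hk (measurable_const_mul a)
  rw [Real.map_volume_mul_left ha.ne', lintegral_smul_measure, abs_of_pos (inv_pos.2 ha)] at h
  exact h.symm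

lemma lintegral_bump (κ : ContDiffBump (0 : ℝ)) :
    ∫⁻ x, ENNReal.ofReal (κ x) = ENNReal.ofReal (∫ x, κ x) :=
  (ofReal_integral_eq_lintegral_ofReal κ.integrable (.of_forall fun _ => κ.nonneg)).symm

lemma lintegral_freq_profile (κ : ContDiffBump (0 : ℝ)) {c : ℝ → ℝ} (hc : Measurable c) :
    ∫⁻ ξ : (Fin 2 → ℝ) × (Fin 2 → ℝ), ENNReal.ofReal (κ (sumFreq ξ) * κ (ξ.2 0) *
        (κ (crossFreq ξ) * c (-(ξ.1 1 + ξ.2 1))))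
      = ENNReal.ofReal (∫ x, κ x) ^ 2 *
        ∫⁻ a, ENNReal.ofReal (c a) * ∫⁻ b, ENNReal.ofReal (κ (a * b)) := by
  let k : ℝ → ℝ≥0∞ := fun x => ENNReal.ofReal (κ x)
  have hk : Measurable k := κ.continuous.measurable.ennreal_ofReal
  let c' : ℝ → ℝ≥0∞ := fun x => ENNReal.ofReal (c x)
  have hc' : Measurable c' := hc.ennreal_ofReal
  have e := lintegral_comp_finTwoArrow fun x => k x.2.1 *
    (k (x.1.1 + x.1.2 + x.2.2) * (k ((x.1.2 + x.2.2) * (x.1.1 + x.2.2)) * c' (-(x.1.2 + x.2.2))))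
  have e1 : ∀ ξ : (Fin 2 → ℝ) × (Fin 2 → ℝ), ENNReal.ofReal (κ (sumFreq ξ) * κ (ξ.2 0) *
        (κ (crossFreq ξ) * c (-(ξ.1 1 + ξ.2 1)))) = k (ξ.2 0) *
    (k (ξ.1 0 + ξ.1 1 + ξ.2 1) *
      (k ((ξ.1 1 + ξ.2 1) * (ξ.1 0 + ξ.2 1)) * c' (-(ξ.1 1 + ξ.2 1)))) := by
    intro ξ
    simp only [k, c', ← ENNReal.ofReal_mul κ.nonneg]
    congr 1
    rw [sumFreq, crossFreq]; ring
  rw [lintegral_congr e1, e, Measure.volume_eq_prod, lintegral_prod_symm _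
    (Measurable.aemeasurable (by fun_prop)), Measure.volume_eq_prod ℝ ℝ, lintegral_prod _
    (Measurable.aemeasurable (by fun_prop))]
  have e2 : ∀ q z : ℝ, ∫⁻ xy : ℝ × ℝ, k q * (k (xy.1 + xy.2 + z) *
      (k ((xy.2 + z) * (xy.1 + z)) * c' (-(xy.2 + z)))) ∂(volume.prod volume)
      = k q * ∫⁻ x, ∫⁻ y, k (x + y + z) * (k ((y + z) * (x + z)) * c' (-(y + z))) := by
    intro q z
    rw [lintegral_const_mul _ (by fun_prop), lintegral_prod _
      (Measurable.aemeasurable (by fun_prop))]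
  simp only [e2]
  have e3 : ∀ q, ∫⁻ z, k q * ∫⁻ x, ∫⁻ y, k (x + y + z) * (k ((y + z) * (x + z)) * c' (-(y + z)))
     = k q * ((∫⁻ x, k x) * ∫⁻ a, c' a * ∫⁻ b, k (a * b)) := by
    intro q
    rw [lintegral_const_mul' _ _ ENNReal.ofReal_ne_top, lintegral_comp_freq hk hc']
  simp only [e3]
  rw [lintegral_mul_const _ hk, lintegral_bump κ, ← mul_assoc, sq]

/-- There are smooth bump functions of arbitrarily large mass supported where the dispersion
relation is small and the Gaussian tests of the two collision terms are well separated. -/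
lemma exists_bump_large_integral {δ : ℝ} (hδ : 0 < δ) (hδ1 : δ ≤ 1) (M : ℝ) :
    ∃ f : (Fin 2 → ℝ) × (Fin 2 → ℝ) → ℝ, ContDiff ℝ ∞ f ∧ HasCompactSupport f ∧
      (∀ ξ, 0 ≤ f ξ) ∧ (∀ ξ, f ξ ≤ 1) ∧
      (∀ ξ, f ξ ≠ 0 → |sumFreq ξ| ≤ δ ∧ |ξ.2 0| ≤ δ ∧ |crossFreq ξ| ≤ δ ∧
        4 ≤ -(ξ.1 1 + ξ.2 1)) ∧
      M ≤ ∫ ξ, f ξ := by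
  let κ : ContDiffBump (0 : ℝ) := ⟨δ / 2, δ, by positivity, by linarith⟩
  set K := ∫ x, κ x with hK
  have hK0 : 0 < K := κ.integral_pos
  obtain ⟨N, hN0, hN⟩ : ∃ N : ℝ, 0 < N ∧ M ≤ K ^ 3 * Real.log ((2 * N + 5) / 5) := by
    refine ⟨(5 * Real.exp (|M| / K ^ 3 + 1) - 5) / 2, ?_, ?_⟩
    · have : 1 < Real.exp (|M| / K ^ 3 + 1) := Real.one_lt_exp_iff.2 (by positivity)
      linarith
    · have : (2 * ((5 * Real.exp (|M| / K ^ 3 + 1) - 5) / 2) + 5) / 5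
        = Real.exp (|M| / K ^ 3 + 1) := by ring
      rw [this, Real.log_exp, mul_add, mul_div_cancel₀ _ (by positivity)]
      have := le_abs_self M
      have : 0 < K ^ 3 := by positivity
      linarith
  let χ : ContDiffBump (N + 5) := ⟨N, N + 1, hN0, by linarith⟩
  let f : (Fin 2 → ℝ) × (Fin 2 → ℝ) → ℝ := fun ξ => κ (sumFreq ξ) * κ (ξ.2 0) *
        (κ (crossFreq ξ) * χ (-(ξ.1 1 + ξ.2 1)))
  have hκ0 : ∀ x, κ x ≠ 0 → |x| ≤ δ := by
    intro x hx
    by_contra! h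
    exact hx (κ.zero_of_le_dist (by simpa [κ] using h.le))
  have hχ0 : ∀ x, χ x ≠ 0 → 4 ≤ x ∧ x ≤ 2 * N + 6 := by
    intro x hx
    have : |x - (N + 5)| ≤ N + 1 := by
      by_contra! h
      exact hx (χ.zero_of_le_dist (by rw [Real.dist_eq]; exact h.le))
    rw [abs_le] at this
    constructor <;> linarith
  have hsm : ContDiff ℝ ∞ f := by
    have h1 : ContDiff ℝ ∞ κ := κ.contDiff
    have h2 : ContDiff ℝ ∞ χ := χ.contDiff
    have c1 : ∀ i, ContDiff ℝ ∞ fun ξ : (Fin 2 → ℝ) × (Fin 2 → ℝ) => ξ.1 i := fun i => by fun_prop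
    have c2 : ∀ i, ContDiff ℝ ∞ fun ξ : (Fin 2 → ℝ) × (Fin 2 → ℝ) => ξ.2 i := fun i => by fun_prop
    have := c1 0
    have := c1 1
    have := c2 0
    have := c2 1
    refine ((h1.comp ?_).mul (h1.comp ?_)).mul ((h1.comp ?_).mul (h2.comp ?_))
    · unfold sumFreq; fun_prop
    · fun_prop
    · unfold crossFreq; fun_prop
    · fun_prop
  have hsupp : ∀ ξ, f ξ ≠ 0 → |sumFreq ξ| ≤ δ ∧ |ξ.2 0| ≤ δ ∧ |crossFreq ξ| ≤ δ ∧
        4 ≤ -(ξ.1 1 + ξ.2 1) ∧ -(ξ.1 1 + ξ.2 1) ≤ 2 * N + 6 := by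
    intro ξ h
    simp only [f, mul_ne_zero_iff] at h
    exact ⟨hκ0 _ h.1.1, hκ0 _ h.1.2, hκ0 _ h.2.1, hχ0 _ h.2.2⟩
  have hcs : HasCompactSupport f := by
    refine HasCompactSupport.of_support_subset_isCompact
      (isCompact_closedBall (0 : (Fin 2 → ℝ) × (Fin 2 → ℝ)) (4 * N + 40)) ?_
    intro ξ hξ
    obtain ⟨h1, h2, h3, h4, h5⟩ := hsupp ξ hξ
    have hb : |ξ.1 0 + ξ.2 1| ≤ 1 := by
      rw [crossFreq, abs_mul] at h3
      have : 4 ≤ |ξ.1 1 + ξ.2 1| := h4.trans (neg_le_abs _)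
      nlinarith [abs_nonneg (ξ.1 0 + ξ.2 1)]
    rw [sumFreq] at h1
    rw [abs_le] at h1 h2 hb
    rw [mem_closedBall_zero_iff, Prod.norm_def]
    refine max_le ((pi_norm_le_iff_of_nonneg (by positivity)).2 ?_)
      ((pi_norm_le_iff_of_nonneg (by positivity)).2 ?_) <;>
    · intro i
      rw [Real.norm_eq_abs, abs_le]
      fin_cases i <;> constructor <;> simp <;> linarith
  have hf0 : ∀ ξ, 0 ≤ f ξ := fun ξ =>
    mul_nonneg (mul_nonneg κ.nonneg κ.nonneg) (mul_nonneg κ.nonneg χ.nonneg)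
  refine ⟨f, hsm, hcs, hf0, fun ξ => ?_,
    fun ξ h => ⟨(hsupp ξ h).1, (hsupp ξ h).2.1, (hsupp ξ h).2.2.1, (hsupp ξ h).2.2.2.1⟩, ?_⟩
  · exact mul_le_one₀ (mul_le_one₀ κ.le_one κ.nonneg κ.le_one)
      (mul_nonneg κ.nonneg χ.nonneg) (mul_le_one₀ κ.le_one χ.nonneg χ.le_one)
  · refine hN.trans ?_
    rw [← ENNReal.ofReal_le_ofReal_iff (integral_nonneg hf0),
      ofReal_integral_eq_lintegral_ofReal (hsm.continuous.integrable_of_hasCompactSupport hcs)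
        (.of_forall hf0), lintegral_freq_profile κ χ.continuous.measurable]
    have hlog : ENNReal.ofReal (Real.log ((2 * N + 5) / 5))
        = ∫⁻ a in Set.Ioc 5 (2 * N + 5), ENNReal.ofReal a⁻¹ := by
      rw [← integral_inv_of_pos (by norm_num) (by positivity),
        intervalIntegral.integral_of_le (by linarith), ofReal_integral_eq_lintegral_ofReal]
      · have : IntervalIntegrable (fun a : ℝ => a⁻¹) volume 5 (2 * N + 5) :=
          intervalIntegral.intervalIntegrable_inv (fun x hx => by
            rw [Set.uIcc_of_le (by linarith)] at hx; linarith [hx.1]) continuousOn_id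
        exact this.1
      · refine (ae_restrict_iff' measurableSet_Ioc).2 (.of_forall fun a ha => ?_)
        exact inv_nonneg.2 (by linarith [ha.1])
    rw [ENNReal.ofReal_mul (by positivity), ENNReal.ofReal_pow hK0.le, hlog, ← hK, pow_succ,
      mul_assoc]
    gcongr
    rw [← lintegral_const_mul _ (by fun_prop)]
    refine le_trans (setLIntegral_mono' measurableSet_Ioc fun a ha => ?_)
      (setLIntegral_le_lintegral (Set.Ioc 5 (2 * N + 5)) _)
    have h1 : χ a = 1 := χ.one_of_mem_closedBall (by
      rw [Metric.mem_closedBall, Real.dist_eq, abs_le]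
      exact ⟨by simp only [χ]; linarith [ha.1], by simp only [χ]; linarith [ha.2]⟩)
    rw [h1, lintegral_comp_mul_of_pos (fun x => ENNReal.ofReal (κ x))
      κ.continuous.measurable.ennreal_ofReal (by linarith [ha.1]), lintegral_bump κ,
      ENNReal.ofReal_one, one_mul, mul_comm]

lemma dispersion_eq (ξ : (Fin 2 → ℝ) × (Fin 2 → ℝ)) :
    dispersion ξ = sumFreq ξ ^ 2 - 2 * crossFreq ξ - ξ.2 0 ^ 2 := by
  simp only [dispersion, sumFreq, crossFreq, Fin.sum_univ_two]; ring

lemma aestronglyMeasurable_collisionEvol {f : (Fin 2 → ℝ) × (Fin 2 → ℝ) → ℝ}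
    (hf : Continuous f) (τ : ℝ) : AEStronglyMeasurable (collisionEvol f τ) := by
  refine StronglyMeasurable.aestronglyMeasurable ?_
  refine StronglyMeasurable.integral_prod_right (f := fun y ξ => collisionKernel y ξ *
    (Complex.exp (((-τ * dispersion ξ : ℝ) : ℂ) * Complex.I) * (f ξ : ℂ))) ?_
  have h1 := continuous_exp_dispersion τ
  have h2 := continuous_collisionKernel
  exact (h2.mul ((h1.comp continuous_snd).mul
    (continuous_ofReal.comp (hf.comp continuous_snd)))).stronglyMeasurable

lemma integral_gaussWeight_mul_collisionEvol {f : (Fin 2 → ℝ) × (Fin 2 → ℝ) → ℝ}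
    (hf : Integrable f) (τ : ℝ) :
    ∫ y, (gaussWeight y : ℂ) * collisionEvol f τ y
      = ∫ ξ, ((2 * Real.pi * (Real.exp (-(sumFreq ξ ^ 2 + ξ.2 0 ^ 2) / 2)
        - Real.exp (-(ξ.1 0 ^ 2 + (ξ.1 1 + ξ.2 0 + ξ.2 1) ^ 2) / 2)) : ℝ) : ℂ) *
        (Complex.exp (((-τ * dispersion ξ : ℝ) : ℂ) * Complex.I) * (f ξ : ℂ)) := by
  have hh := integrable_exp_dispersion_mul hf τ
  have hint : Integrable (Function.uncurry fun y ξ => collisionKernel y ξ * ((gaussWeight y : ℂ) *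
      (Complex.exp (((-τ * dispersion ξ : ℝ) : ℂ) * Complex.I) * (f ξ : ℂ)))) :=
    (integrable_gaussWeight.ofReal.mul_prod hh).bdd_mul (c := 2)
      continuous_collisionKernel.aestronglyMeasurable
      (.of_forall fun x => norm_collisionKernel_le x.1 x.2)
  have h1 : ∀ y, (gaussWeight y : ℂ) * collisionEvol f τ y
      = ∫ ξ, collisionKernel y ξ * ((gaussWeight y : ℂ) *
      (Complex.exp (((-τ * dispersion ξ : ℝ) : ℂ) * Complex.I) * (f ξ : ℂ))) := by
    intro y
    rw [collisionEvol, ← integral_const_mul]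
    refine integral_congr_ae (.of_forall fun ξ => ?_)
    ring
  simp only [h1]
  rw [integral_integral_swap hint]
  refine integral_congr_ae (.of_forall fun ξ => ?_)
  simp only
  rw [sumFreq, ← integral_gaussWeight_mul_collisionKernel, ← integral_mul_const]
  refine integral_congr_ae (.of_forall fun y => ?_)
  ring

/-- The lower bound on the Gaussian symbol that is available on the support of the bumps. -/
def gaussGap : ℝ := 2 * Real.pi * (Real.exp (-1) - Real.exp (-9))

lemma gaussGap_pos : 0 < gaussGap := by
  have : Real.exp (-9) < Real.exp (-1) := Real.exp_lt_exp.2 (by norm_num)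
  have := Real.pi_pos
  unfold gaussGap
  have : 0 < Real.exp (-1) - Real.exp (-9) := by linarith
  positivity

lemma half_gaussGap_le {τ T δ : ℝ} (hτ0 : 0 ≤ τ) (hτ : τ ≤ T) (hδ0 : 0 ≤ δ) (hδ : δ ≤ 1)
    (hδT : 4 * δ * T ≤ 1)
    {ξ : (Fin 2 → ℝ) × (Fin 2 → ℝ)} (hp : |sumFreq ξ| ≤ δ) (hq : |ξ.2 0| ≤ δ)
    (hc : |crossFreq ξ| ≤ δ) (ha : 4 ≤ -(ξ.1 1 + ξ.2 1)) :
    gaussGap / 2 ≤ 2 * Real.pi * (Real.exp (-(sumFreq ξ ^ 2 + ξ.2 0 ^ 2) / 2)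
        - Real.exp (-(ξ.1 0 ^ 2 + (ξ.1 1 + ξ.2 0 + ξ.2 1) ^ 2) / 2)) *
        Real.cos (-τ * dispersion ξ) := by
  have hp2 : sumFreq ξ ^ 2 ≤ δ := by
    rw [← sq_abs]; nlinarith [abs_nonneg (sumFreq ξ)]
  have hq2 : ξ.2 0 ^ 2 ≤ δ := by
    rw [← sq_abs]; nlinarith [abs_nonneg (ξ.2 0)]
  have hD : |dispersion ξ| ≤ 4 * δ := by
    rw [abs_le] at *
    rw [dispersion_eq]
    constructor <;> nlinarith [sq_nonneg (sumFreq ξ), sq_nonneg (ξ.2 0)]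
  have hcos : 1 / 2 ≤ Real.cos (-τ * dispersion ξ) := by
    have h1 : |-τ * dispersion ξ| ≤ 1 := by
      rw [abs_mul, abs_neg, abs_of_nonneg hτ0]
      calc τ * |dispersion ξ| ≤ T * (4 * δ) :=
            mul_le_mul hτ hD (abs_nonneg _) (hτ0.trans hτ)
        _ ≤ 1 := by linarith
    have h2 := Real.one_sub_sq_div_two_le_cos (x := -τ * dispersion ξ)
    have h3 : (-τ * dispersion ξ) ^ 2 ≤ 1 := (sq_le_one_iff_abs_le_one _).2 h1
    linarith
  have he1 : Real.exp (-1) ≤ Real.exp (-(sumFreq ξ ^ 2 + ξ.2 0 ^ 2) / 2) :=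
    Real.exp_le_exp.2 (by linarith)
  have he2 : Real.exp (-(ξ.1 0 ^ 2 + (ξ.1 1 + ξ.2 0 + ξ.2 1) ^ 2) / 2) ≤ Real.exp (-9) := by
    refine Real.exp_le_exp.2 ?_
    rw [abs_le] at hp hq
    rw [sumFreq] at hp
    have h1 : 3 ≤ ξ.1 0 := by linarith
    have h2 : ξ.1 1 + ξ.2 0 + ξ.2 1 ≤ -3 := by linarith
    nlinarith
  have hg : gaussGap ≤ 2 * Real.pi * (Real.exp (-(sumFreq ξ ^ 2 + ξ.2 0 ^ 2) / 2)
        - Real.exp (-(ξ.1 0 ^ 2 + (ξ.1 1 + ξ.2 0 + ξ.2 1) ^ 2) / 2)) := by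
    unfold gaussGap
    have := Real.pi_pos
    gcongr
  rw [div_eq_mul_one_div]
  exact mul_le_mul hg hcos (by norm_num) (gaussGap_pos.le.trans hg)

lemma le_norm_integral_gaussWeight_mul_collisionEvol {f : (Fin 2 → ℝ) × (Fin 2 → ℝ) → ℝ}
    (hf : Integrable f) (hf0 : ∀ ξ, 0 ≤ f ξ) {τ T δ : ℝ} (hτ0 : 0 ≤ τ) (hτ : τ ≤ T)
    (hδ0 : 0 ≤ δ) (hδ : δ ≤ 1) (hδT : 4 * δ * T ≤ 1)
    (hsupp : ∀ ξ, f ξ ≠ 0 → |sumFreq ξ| ≤ δ ∧ |ξ.2 0| ≤ δ ∧ |crossFreq ξ| ≤ δ ∧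
      4 ≤ -(ξ.1 1 + ξ.2 1)) :
    gaussGap / 2 * ∫ ξ, f ξ ≤ ‖∫ y, (gaussWeight y : ℂ) * collisionEvol f τ y‖ := by
  refine le_trans ?_ (Complex.re_le_norm _)
  rw [integral_gaussWeight_mul_collisionEvol hf, ← integral_const_mul]
  let G : (Fin 2 → ℝ) × (Fin 2 → ℝ) → ℝ := fun ξ =>
    2 * Real.pi * (Real.exp (-(sumFreq ξ ^ 2 + ξ.2 0 ^ 2) / 2)
        - Real.exp (-(ξ.1 0 ^ 2 + (ξ.1 1 + ξ.2 0 + ξ.2 1) ^ 2) / 2))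
  have hGc : Continuous G := by unfold G sumFreq; fun_prop
  have hGb : ∀ ξ, ‖(G ξ : ℂ)‖ ≤ 2 * Real.pi := by
    intro ξ
    rw [Complex.norm_real, Real.norm_eq_abs, abs_mul, abs_of_pos Real.two_pi_pos]
    refine mul_le_of_le_one_right Real.two_pi_pos.le (abs_sub_le_of_nonneg_of_le
      (Real.exp_pos _).le (Real.exp_le_one_iff.2 ?_) (Real.exp_pos _).le
      (Real.exp_le_one_iff.2 ?_))
    · nlinarith [sq_nonneg (sumFreq ξ), sq_nonneg (ξ.2 0)]
    · nlinarith [sq_nonneg (ξ.1 0), sq_nonneg (ξ.1 1 + ξ.2 0 + ξ.2 1)]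
  have hint : Integrable fun ξ => (G ξ : ℂ) *
      (Complex.exp (((-τ * dispersion ξ : ℝ) : ℂ) * Complex.I) * (f ξ : ℂ)) :=
    (integrable_exp_dispersion_mul hf τ).bdd_mul (c := 2 * Real.pi)
      (continuous_ofReal.comp hGc).aestronglyMeasurable (.of_forall hGb)
  have hre := integral_re hint
  refine le_trans ?_ hre.le
  refine integral_mono (hf.const_mul _) hint.re fun ξ => ?_
  have e : RCLike.re ((G ξ : ℂ) *
      (Complex.exp (((-τ * dispersion ξ : ℝ) : ℂ) * Complex.I) * (f ξ : ℂ)))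
      = G ξ * Real.cos (-τ * dispersion ξ) * f ξ := by
    rw [RCLike.re_eq_complex_re, Complex.re_ofReal_mul, Complex.re_mul_ofReal,
      Complex.exp_ofReal_mul_I_re]
    ring
  simp only [e]
  by_cases h : f ξ = 0
  · simp [h]
  · obtain ⟨h1, h2, h3, h4⟩ := hsupp ξ h
    exact mul_le_mul_of_nonneg_right
      (half_gaussGap_le hτ0 hτ hδ0 hδ hδT h1 h2 h3 h4) (hf0 ξ)

lemma enorm_integral_mul_sq_le {k : ℕ} {w g : (Fin k → ℝ) × (Fin k → ℝ) → ℂ}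
    (hw : AEStronglyMeasurable w) (hg : AEStronglyMeasurable g) :
    ‖∫ y, w y * g y‖ₑ ^ 2 ≤ L2E k w ^ 2 * L2E k g ^ 2 := by
  rw [← mul_pow]
  gcongr
  refine (enorm_integral_le_lintegral_enorm _).trans ?_
  simp only [enorm_mul]
  have h := ENNReal.lintegral_mul_le_Lp_mul_Lq volume Real.HolderConjugate.two_two
    hw.enorm hg.enorm
  simpa [L2E, enorm_eq_nnnorm] using h

lemma L2E_gaussWeight_sq_ne_top : L2E 1 (fun y => (gaussWeight y : ℂ)) ^ 2 ≠ ⊤ := by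
  rw [L2E_sq]
  refine ((lintegral_mono fun y => ?_).trans_lt
    integrable_gaussWeight.hasFiniteIntegral).ne
  rw [Complex.nnnorm_real, ← enorm_eq_nnnorm, sq]
  refine mul_le_of_le_one_right' ?_
  rw [Real.enorm_eq_ofReal (gaussWeight_pos y).le]
  exact ENNReal.ofReal_le_one.2 (gaussWeight_le_one y)

lemma ofReal_sq_le_L2E_collisionEvol {f : (Fin 2 → ℝ) × (Fin 2 → ℝ) → ℝ}
    (hf : Integrable f) (hfc : Continuous f) (hf0 : ∀ ξ, 0 ≤ f ξ) {τ T δ : ℝ}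
    (hτ0 : 0 ≤ τ) (hτ : τ ≤ T) (hδ0 : 0 ≤ δ) (hδ : δ ≤ 1) (hδT : 4 * δ * T ≤ 1)
    (hsupp : ∀ ξ, f ξ ≠ 0 → |sumFreq ξ| ≤ δ ∧ |ξ.2 0| ≤ δ ∧ |crossFreq ξ| ≤ δ ∧
      4 ≤ -(ξ.1 1 + ξ.2 1)) :
    ENNReal.ofReal ((gaussGap / 2 * ∫ ξ, f ξ) ^ 2) ≤
      L2E 1 (fun y => (gaussWeight y : ℂ)) ^ 2 * L2E 1 (collisionEvol f τ) ^ 2 := by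
  refine le_trans ?_ (enorm_integral_mul_sq_le
    (continuous_ofReal.comp continuous_gaussWeight).aestronglyMeasurable
    (aestronglyMeasurable_collisionEvol hfc τ))
  rw [ENNReal.ofReal_pow (mul_nonneg (by linarith [gaussGap_pos]) (integral_nonneg hf0))]
  gcongr
  rw [← ofReal_norm]
  exact ENNReal.ofReal_le_ofReal
    (le_norm_integral_gaussWeight_mul_collisionEvol hf hf0 hτ0 hτ hδ0 hδ hδT hsupp)

/-- **Failure of the 1D collapsing estimate without derivative gain** (optimality part of
Theorem 1.3): for every `T > 0` there is no constant `C` such that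
`(∫_0^T ‖B_{1,2} U^{(2)}(τ) φ‖_{L²}² dτ)^{1/2} ≤ C ‖φ‖_{L²}` holds for all Schwartz `φ`. -/
theorem no_collapsing_without_derivatives (T : ℝ) (hT : 0 < T) :
    ¬ ∃ C : ℝ, ∀ φ : SchwartzMap ((Fin 2 → ℝ) × (Fin 2 → ℝ)) ℂ,
      (∫⁻ τ in Set.Ioc (0 : ℝ) T,
          (L2E 1 (collision 1 0 (fun y => freeEvol 2 τ (⇑φ) y))) ^ 2) ^ (1/2 : ℝ)
        ≤ ENNReal.ofReal C * L2E 2 ⇑φ := by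
  rintro ⟨C, hC⟩
  set g : ℝ := gaussGap / 2 with hg
  have hg0 : 0 < g := half_pos gaussGap_pos
  let W : ℝ≥0∞ := L2E 1 (fun y => (gaussWeight y : ℂ)) ^ 2
  set A : ℝ := W.toReal * (max C 0 ^ 2 * (2 * Real.pi) ^ 4) with hA
  have hA0 : 0 ≤ A := by positivity
  obtain ⟨δ, hδ0, hδ1, hδT⟩ : ∃ δ : ℝ, 0 < δ ∧ δ ≤ 1 ∧ 4 * δ * T ≤ 1 := by
    refine ⟨min 1 (1 / (4 * T)), by positivity, min_le_left _ _, ?_⟩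
    have h : min 1 (1 / (4 * T)) * (4 * T) ≤ 1 :=
      (le_div_iff₀ (by positivity)).1 (min_le_right _ _)
    linarith
  obtain ⟨f, hsm, hcs, hf0, hf1, hsupp, hM⟩ :=
    exists_bump_large_integral hδ0 hδ1 (A / (T * g ^ 2) + 1)
  have hf : Integrable f := hsm.continuous.integrable_of_hasCompactSupport hcs
  obtain ⟨φ, hφ, hφ2⟩ := exists_ftK_eq f hsm hcs
  have hsq : ∫⁻ τ in Set.Ioc (0 : ℝ) T, L2E 1 (collisionEvol f τ) ^ 2
      ≤ ENNReal.ofReal C ^ 2 * L2E 2 φ ^ 2 := by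
    have h := ENNReal.rpow_le_rpow (hC φ) (zero_le_two (α := ℝ))
    rw [← ENNReal.rpow_mul, one_div_mul_cancel two_ne_zero, ENNReal.rpow_one,
      ENNReal.rpow_two, mul_pow] at h
    refine le_of_eq_of_le (lintegral_congr fun τ => ?_) h
    rw [show collision 1 0 (fun y => freeEvol 2 τ φ y) = collisionEvol f τ from
      funext fun y => collision_freeEvol_eq hf hφ τ y]
  have hf2 : ∫ ξ, f ξ ^ 2 ≤ ∫ ξ, f ξ :=
    integral_mono_of_nonneg (.of_forall fun ξ => sq_nonneg _) hf
      (.of_forall fun ξ => pow_le_of_le_one (hf0 ξ) (hf1 ξ) two_ne_zero)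
  have hint : ENNReal.ofReal (T * (g * ∫ ξ, f ξ) ^ 2) ≤ ENNReal.ofReal (A * ∫ ξ, f ξ) := by
    calc ENNReal.ofReal (T * (g * ∫ ξ, f ξ) ^ 2)
        = ∫⁻ _ in Set.Ioc (0 : ℝ) T, ENNReal.ofReal ((g * ∫ ξ, f ξ) ^ 2) := by
          rw [setLIntegral_const, Real.volume_Ioc, sub_zero, mul_comm,
            ENNReal.ofReal_mul (by positivity)]
      _ ≤ ∫⁻ τ in Set.Ioc (0 : ℝ) T, W * L2E 1 (collisionEvol f τ) ^ 2 :=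
          setLIntegral_mono' measurableSet_Ioc fun τ hτ =>
            ofReal_sq_le_L2E_collisionEvol hf hsm.continuous hf0 hτ.1.le hτ.2 hδ0.le hδ1 hδT hsupp
      _ = W * ∫⁻ τ in Set.Ioc (0 : ℝ) T, L2E 1 (collisionEvol f τ) ^ 2 :=
          lintegral_const_mul' _ _ L2E_gaussWeight_sq_ne_top
      _ ≤ W * (ENNReal.ofReal C ^ 2 * L2E 2 φ ^ 2) := by gcongr
      _ ≤ ENNReal.ofReal W.toReal * (ENNReal.ofReal (max C 0) ^ 2 *
            ENNReal.ofReal ((2 * Real.pi) ^ 4 * ∫ ξ, f ξ)) := by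
          rw [hφ2, ENNReal.ofReal_toReal L2E_gaussWeight_sq_ne_top]
          gcongr
          exact le_max_left _ _
      _ = ENNReal.ofReal (A * ∫ ξ, f ξ) := by
          rw [← ENNReal.ofReal_pow (le_max_right _ _), ← ENNReal.ofReal_mul (by positivity),
            ← ENNReal.ofReal_mul ENNReal.toReal_nonneg, hA]
          congr 1
          ring
  have hI : 0 < ∫ ξ, f ξ := by
    have : 0 ≤ A / (T * g ^ 2) := by positivity
    linarith
  rw [ENNReal.ofReal_le_ofReal_iff (by positivity)] at hint
  have h1 : (∫ ξ, f ξ) * (T * g ^ 2) ≤ A := by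
    refine le_of_mul_le_mul_right ?_ hI
    linarith
  have h2 := (le_div_iff₀ (by positivity)).2 h1
  linarith

end
end

section
/- Uniform bound on the multiplier integral in the proof of the collapsing estimate: Let 0 < ε < 1/8 and let θ : ℝ → ℂ be smooth and compactly supported, with Fourier transform θ̂(ξ) = ∫_ℝ e^{−ixξ} θ(x) dx. Then there is a constant C (depending on ε and θ) such that for all η, ξ₁ ∈ ℝ, ∬_{ℝ²} ⟨ξ₁⟩^{2ε} |θ̂( η + (ξ₁ − ξ₂ − ξ₂')² − ξ₁² + ξ₂² − (ξ₂')² )| / ( ⟨ξ₁ − ξ₂ − ξ₂'⟩^{2ε} ⟨ξ₂⟩^{2ε} ⟨ξ₂'⟩^{2ε} ) dξ₂ dξ₂' ≤ C. -/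
open MeasureTheory
open scoped ENNReal

noncomputable section

/-- The Fourier transform `θ̂(ξ) = ∫ e^{-ixξ} θ(x) dx` of `θ : ℝ → ℂ`. -/
def ft1 (θ : ℝ → ℂ) (ξ : ℝ) : ℂ := ∫ x : ℝ, Complex.exp (-Complex.I * ((x * ξ : ℝ) : ℂ)) * θ x

theorem one_le_jap (x : ℝ) : 1 ≤ jap x :=
  Real.one_le_sqrt.2 (by nlinarith [sq_nonneg x])

theorem jap_pos (x : ℝ) : 0 < jap x := one_pos.trans_le (one_le_jap x)

@[fun_prop]
theorem continuous_jap : Continuous jap := by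
  unfold jap
  fun_prop

theorem abs_le_jap (x : ℝ) : |x| ≤ jap x :=
  Real.abs_le_sqrt (by linarith)

theorem jap_le_one_add_abs (x : ℝ) : jap x ≤ 1 + |x| :=
  Real.sqrt_le_iff.2 ⟨by positivity, by nlinarith [sq_abs x, abs_nonneg x]⟩

theorem jap_neg (x : ℝ) : jap (-x) = jap x := by
  simp [jap]

theorem jap_add_le (x y : ℝ) : jap (x + y) ≤ jap x + jap y := by
  have hx : jap x ^ 2 = 1 + x ^ 2 := Real.sq_sqrt (by positivity)
  have hy : jap y ^ 2 = 1 + y ^ 2 := Real.sq_sqrt (by positivity)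
  have h : |x| * |y| ≤ jap x * jap y :=
    mul_le_mul (abs_le_jap x) (abs_le_jap y) (abs_nonneg y) (jap_pos x).le
  rw [← abs_mul] at h
  exact Real.sqrt_le_iff.2 ⟨(add_pos (jap_pos x) (jap_pos y)).le,
    by nlinarith [le_abs_self (x * y)]⟩

theorem jap_sub_le (x y : ℝ) : jap (x - y) ≤ jap x + jap y := by
  simpa [sub_eq_add_neg, jap_neg] using jap_add_le x (-y)

/-- The quotient of brackets is controlled by the bracket of a variable that is not small. -/
theorem jap_div_cases (N x y : ℝ) :
    (1 ≤ |x| ∧ jap N / (jap (N - x) * jap (N - y) * jap (x + y - N)) ≤ 7 / jap (N - x)) ∨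
    (1 ≤ |y| ∧ jap N / (jap (N - x) * jap (N - y) * jap (x + y - N)) ≤ 7 / jap (N - y)) ∨
    (|x| < 1 ∧ |y| < 1 ∧ jap N / (jap (N - x) * jap (N - y) * jap (x + y - N)) ≤ 7) := by
  have hN : jap N ≤ jap (N - x) + jap (N - y) + jap (x + y - N) := by
    have h1 := jap_add_le (N - x + (N - y)) (x + y - N)
    have h2 := jap_add_le (N - x) (N - y)
    rw [show N - x + (N - y) + (x + y - N) = N by ring] at h1
    linarith
  have hx : jap (N - x) ≤ jap (x + y - N) + jap y := by
    have h := jap_sub_le y (x + y - N)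
    rw [show y - (x + y - N) = N - x by ring] at h
    linarith
  have hy : jap (N - y) ≤ jap (x + y - N) + jap x := by
    have h := jap_sub_le x (x + y - N)
    rw [show x - (x + y - N) = N - y by ring] at h
    linarith
  have hx' := jap_le_one_add_abs x
  have hy' := jap_le_one_add_abs y
  have hA := one_le_jap (N - x)
  have hB := one_le_jap (N - y)
  have hD := one_le_jap (x + y - N)
  generalize jap (N - x) = A at *
  generalize jap (N - y) = B at *
  generalize jap (x + y - N) = D at *
  have hAB := mul_le_mul hA hB zero_le_one (by linarith)
  have hAD := mul_le_mul hA hD zero_le_one (by linarith)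
  have hBD := mul_le_mul hB hD zero_le_one (by linarith)
  have hq : 0 < A * B * D := by positivity
  have key_A (h : A + B + D ≤ 7 * (B * D)) : jap N / (A * B * D) ≤ 7 / A := by
    rw [div_le_div_iff₀ hq (by linarith)]
    nlinarith
  have key_B (h : A + B + D ≤ 7 * (A * D)) : jap N / (A * B * D) ≤ 7 / B := by
    rw [div_le_div_iff₀ hq (by linarith)]
    nlinarith
  rcases le_or_gt 1 |x| with h1 | h1 <;> rcases le_or_gt 1 |y| with h2 | h2
  · rcases le_total A B with h | h
    · exact .inl ⟨h1, key_A (by nlinarith)⟩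
    · exact .inr (.inl ⟨h2, key_B (by nlinarith)⟩)
  · exact .inl ⟨h1, key_A (by nlinarith)⟩
  · exact .inr (.inl ⟨h2, key_B (by nlinarith)⟩)
  · refine .inr (.inr ⟨h1, h2, ?_⟩)
    rw [div_le_iff₀ hq]
    nlinarith [mul_le_mul hAB hD zero_le_one (by positivity)]

theorem inv_abs_mul_jap_rpow_le {ε : ℝ} (hε : 0 < ε) {x : ℝ} (hx : 1 ≤ |x|) (z : ℝ) :
    |x|⁻¹ * jap z ^ (-(2 * ε)) ≤
      2 * (jap x ^ (-(1 + 2 * ε)) + jap z ^ (-(1 + 2 * ε))) := by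
  have hpx := jap_pos x
  have hpz := jap_pos z
  have h1 : |x|⁻¹ ≤ 2 * jap x ^ (-1 : ℝ) := by
    rw [Real.rpow_neg_one, ← div_eq_mul_inv, inv_eq_one_div, div_le_div_iff₀ (by linarith) hpx]
    linarith [jap_le_one_add_abs x]
  have h2 : jap x ^ (-1 : ℝ) * jap z ^ (-(2 * ε)) ≤
      jap x ^ (-(1 + 2 * ε)) + jap z ^ (-(1 + 2 * ε)) := by
    rw [neg_add, Real.rpow_add hpx, Real.rpow_add hpz]
    rcases le_total (jap x) (jap z) with h | h
    · have h3 : jap z ^ (-(2 * ε)) ≤ jap x ^ (-(2 * ε)) :=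
        Real.rpow_le_rpow_of_nonpos hpx h (by linarith)
      calc _ ≤ jap x ^ (-1 : ℝ) * jap x ^ (-(2 * ε)) := by gcongr
        _ ≤ _ := le_add_of_nonneg_right (by positivity)
    · have h3 : jap x ^ (-1 : ℝ) ≤ jap z ^ (-1 : ℝ) :=
        Real.rpow_le_rpow_of_nonpos hpz h (by linarith)
      calc _ ≤ jap z ^ (-1 : ℝ) * jap z ^ (-(2 * ε)) := by gcongr
        _ ≤ _ := le_add_of_nonneg_left (by positivity)
  calc _ ≤ 2 * jap x ^ (-1 : ℝ) * jap z ^ (-(2 * ε)) := by gcongr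
    _ ≤ _ := by linarith

theorem lintegral_jap_rpow_lt_top {r : ℝ} (hr : 1 < r) :
    ∫⁻ x, ENNReal.ofReal (jap x ^ (-r)) < ∞ := by
  have h : Integrable (fun x : ℝ ↦ jap x ^ (-r)) := by
    convert integrable_rpow_neg_one_add_norm_sq (E := ℝ) (μ := volume) (r := r) (by simpa) using 2
      with x
    rw [jap, Real.sqrt_eq_rpow, ← Real.rpow_mul (by positivity), Real.norm_eq_abs, sq_abs]
    ring_nf
  exact h.lintegral_lt_top

theorem lintegral_comp_sub_mul {G : ℝ → ℝ≥0∞} (hG : Measurable G) (η : ℝ) {c : ℝ} (hc : c ≠ 0) :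
    ∫⁻ y, G (η - c * y) = ENNReal.ofReal |c⁻¹| * ∫⁻ y, G y := by
  have h := lintegral_map (μ := volume) (f := fun y ↦ G (η - y)) (g := (c * ·))
    (by fun_prop) (by fun_prop)
  rw [Real.map_volume_mul_left hc, lintegral_smul_measure, lintegral_sub_left_eq_self] at h
  exact h.symm

/-- The contribution of `|x| ≥ 1` to the integral, bounded uniformly in `η` and `N`. -/
theorem lintegral_lintegral_outer_le {ε : ℝ} (hε : 0 < ε) {G : ℝ → ℝ≥0∞} (hG : Measurable G)
    (η N : ℝ) :
    ∫⁻ x, ∫⁻ y, G (η - 2 * x * y) *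
        {x : ℝ | 1 ≤ |x|}.indicator (fun x ↦ ENNReal.ofReal (jap (N - x) ^ (-(2 * ε)))) x ≤
      4 * (∫⁻ x, ENNReal.ofReal (jap x ^ (-(1 + 2 * ε)))) * ∫⁻ t, G t := by
  have hpt (x : ℝ) : ∫⁻ y, G (η - 2 * x * y) *
        {x : ℝ | 1 ≤ |x|}.indicator (fun x ↦ ENNReal.ofReal (jap (N - x) ^ (-(2 * ε)))) x ≤
      2 * (ENNReal.ofReal (jap x ^ (-(1 + 2 * ε))) +
        ENNReal.ofReal (jap (N - x) ^ (-(1 + 2 * ε)))) * ∫⁻ t, G t := by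
    by_cases hx : 1 ≤ |x|
    · have hx0 : x ≠ 0 := by
        rintro rfl
        norm_num at hx
      rw [Set.indicator_of_mem (by exact hx), lintegral_mul_const _ (by fun_prop),
        lintegral_comp_sub_mul hG η (mul_ne_zero two_ne_zero hx0), mul_right_comm]
      refine mul_le_mul' ?_ le_rfl
      rw [← ENNReal.ofReal_mul (abs_nonneg _), ← ENNReal.ofReal_add
        (Real.rpow_nonneg (jap_pos _).le _) (Real.rpow_nonneg (jap_pos _).le _),
        ← ENNReal.ofReal_ofNat 2, ← ENNReal.ofReal_mul (by norm_num)]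
      refine ENNReal.ofReal_le_ofReal (le_trans ?_ (inv_abs_mul_jap_rpow_le hε hx _))
      refine mul_le_mul_of_nonneg_right ?_ (Real.rpow_nonneg (jap_pos _).le _)
      rw [abs_inv, abs_mul, abs_two]
      exact inv_anti₀ (by linarith) (by linarith)
    · simp [Set.indicator_of_notMem (s := {x : ℝ | 1 ≤ |x|}) hx]
  refine (lintegral_mono hpt).trans_eq ?_
  rw [lintegral_mul_const _ (by fun_prop), lintegral_const_mul _ (by fun_prop),
    lintegral_add_left (by fun_prop),
    lintegral_sub_left_eq_self (fun x ↦ ENNReal.ofReal (jap x ^ (-(1 + 2 * ε))))]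
  ring

theorem ft1_eq_fourier (θ : ℝ → ℂ) (ξ : ℝ) :
    ft1 θ ξ = FourierTransform.fourier θ (ξ / (2 * Real.pi)) := by
  rw [Real.fourier_real_eq_integral_exp_smul, ft1]
  congr 1 with x
  rw [smul_eq_mul]
  congr 2
  have : (Real.pi : ℂ) ≠ 0 := by exact_mod_cast Real.pi_ne_zero
  push_cast
  field_simp

theorem norm_ft1_le (θ : ℝ → ℂ) (ξ : ℝ) : ‖ft1 θ ξ‖ ≤ ∫ x, ‖θ x‖ := by
  refine (norm_integral_le_integral_norm _).trans_eq ?_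
  congr 1 with x
  rw [norm_mul, neg_mul_comm, mul_comm Complex.I, ← Complex.ofReal_neg,
    Complex.norm_exp_ofReal_mul_I, one_mul]

theorem continuous_integrable_ft1 {θ : ℝ → ℂ} (hθs : ContDiff ℝ (⊤ : ℕ∞) θ)
    (hθc : HasCompactSupport θ) : Continuous (ft1 θ) ∧ Integrable (ft1 θ) := by
  have h : ft1 θ = fun ξ ↦
      FourierTransform.fourier (hθc.toSchwartzMap hθs) (ξ / (2 * Real.pi)) := by
    ext ξ
    rw [ft1_eq_fourier, SchwartzMap.fourier_coe]
    rfl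
  rw [h]
  refine ⟨by fun_prop, ?_⟩
  exact (SchwartzMap.integrable _).comp_div (by positivity)

/-- The multiplier integrand in the variables `x = ξ₁ - ξ₂`, `y = ξ₂ + ξ₂'`. -/
theorem multiplier_le {ε : ℝ} (hε : 0 < ε) (N x y : ℝ) {g : ℝ} (hg : 0 ≤ g) :
    ENNReal.ofReal (jap N ^ (2 * ε) * g /
      (jap (N - y) ^ (2 * ε) * jap (N - x) ^ (2 * ε) * jap (x + y - N) ^ (2 * ε))) ≤
    ENNReal.ofReal (7 ^ (2 * ε)) * (ENNReal.ofReal g *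
        {x : ℝ | 1 ≤ |x|}.indicator (fun x ↦ ENNReal.ofReal (jap (N - x) ^ (-(2 * ε)))) x +
      ENNReal.ofReal g *
        {y : ℝ | 1 ≤ |y|}.indicator (fun y ↦ ENNReal.ofReal (jap (N - y) ^ (-(2 * ε)))) y +
      ENNReal.ofReal g * ((Set.Ioo (-1) 1).indicator 1 x * (Set.Ioo (-1) 1).indicator 1 y)) := by
  have hN := jap_pos N
  have hA := jap_pos (N - x)
  have hB := jap_pos (N - y)
  have hD := jap_pos (x + y - N)
  have hq : jap N ^ (2 * ε) * g /
      (jap (N - y) ^ (2 * ε) * jap (N - x) ^ (2 * ε) * jap (x + y - N) ^ (2 * ε)) =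
      (jap N / (jap (N - x) * jap (N - y) * jap (x + y - N))) ^ (2 * ε) * g := by
    rw [Real.div_rpow hN.le (by positivity), Real.mul_rpow (by positivity) hD.le,
      Real.mul_rpow hA.le hB.le]
    ring
  have hdiv {A : ℝ} (hA : 0 < A) : (7 / A) ^ (2 * ε) = 7 ^ (2 * ε) * A ^ (-(2 * ε)) := by
    rw [Real.div_rpow (by norm_num) hA.le, Real.rpow_neg hA.le, div_eq_mul_inv]
  have hbound {b : ℝ} (hb : 0 ≤ b)
      (h : jap N / (jap (N - x) * jap (N - y) * jap (x + y - N)) ≤ b) :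
      ENNReal.ofReal ((jap N / (jap (N - x) * jap (N - y) * jap (x + y - N))) ^ (2 * ε) * g) ≤
        ENNReal.ofReal (b ^ (2 * ε)) * ENNReal.ofReal g := by
    rw [← ENNReal.ofReal_mul (Real.rpow_nonneg hb _)]
    gcongr
  rw [hq]
  rcases jap_div_cases N x y with ⟨hx, h⟩ | ⟨hy, h⟩ | ⟨hx, hy, h⟩
  · refine (hbound (by positivity) h).trans ?_
    rw [hdiv hA, ENNReal.ofReal_mul (by positivity), mul_assoc,
      Set.indicator_of_mem (s := {x : ℝ | 1 ≤ |x|}) hx, mul_comm (ENNReal.ofReal (_ ^ _))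
      (ENNReal.ofReal g), add_assoc]
    gcongr
    exact le_self_add
  · refine (hbound (by positivity) h).trans ?_
    rw [hdiv hB, ENNReal.ofReal_mul (by positivity), mul_assoc,
      Set.indicator_of_mem (s := {y : ℝ | 1 ≤ |y|}) hy, mul_comm (ENNReal.ofReal (_ ^ _))
      (ENNReal.ofReal g)]
    gcongr
    exact le_add_self.trans le_self_add
  · refine (hbound (by positivity) h).trans ?_
    rw [Set.indicator_of_mem (s := Set.Ioo (-1) 1) (abs_lt.1 hx),
      Set.indicator_of_mem (s := Set.Ioo (-1) 1) (abs_lt.1 hy)]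
    gcongr
    simp

theorem lintegral_prod_eq_shear {F : ℝ × ℝ → ℝ≥0∞} (hF : Measurable F) (N : ℝ) :
    ∫⁻ p, F p = ∫⁻ x, ∫⁻ y, F (N - x, x + y - N) := by
  rw [Measure.volume_eq_prod, lintegral_prod _ hF.aemeasurable,
    ← lintegral_sub_left_eq_self _ N]
  congr 1 with x
  rw [← lintegral_add_left_eq_self _ (x - N)]
  congr 1 with y
  ring_nf

/-- **Uniform bound on the multiplier integral** in the proof of the collapsing estimate:
for `0 < ε < 1/8` and `θ` smooth compactly supported, the integral
`∬ ⟨ξ₁⟩^{2ε} |θ̂(η + (ξ₁-ξ₂-ξ₂')² - ξ₁² + ξ₂² - (ξ₂')²)| /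
  (⟨ξ₁-ξ₂-ξ₂'⟩^{2ε} ⟨ξ₂⟩^{2ε} ⟨ξ₂'⟩^{2ε}) dξ₂ dξ₂'`
is bounded uniformly in `η, ξ₁`. -/
theorem multiplier_integral_bound (ε : ℝ) (hε0 : 0 < ε) (hε : ε < 1/8)
    (θ : ℝ → ℂ) (hθs : ContDiff ℝ (⊤ : ℕ∞) θ) (hθc : HasCompactSupport θ) :
    ∃ C : ℝ, ∀ η ξ₁ : ℝ,
      (∫⁻ p : ℝ × ℝ, ENNReal.ofReal
        (jap ξ₁ ^ (2*ε) *
          ‖ft1 θ (η + (ξ₁ - p.1 - p.2) ^ 2 - ξ₁ ^ 2 + p.1 ^ 2 - p.2 ^ 2)‖ /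
          (jap (ξ₁ - p.1 - p.2) ^ (2*ε) * jap p.1 ^ (2*ε) * jap p.2 ^ (2*ε))))
        ≤ ENNReal.ofReal C := by
  obtain ⟨hcont, hint⟩ := continuous_integrable_ft1 hθs hθc
  set G : ℝ → ℝ≥0∞ := fun t ↦ ENNReal.ofReal ‖ft1 θ t‖
  have hG : Measurable G := by fun_prop
  have hGint : ∫⁻ t, G t < ∞ := hint.norm.lintegral_lt_top
  set M := ENNReal.ofReal (∫ x, ‖θ x‖)
  have hGM (t : ℝ) : G t ≤ M := ENNReal.ofReal_le_ofReal (norm_ft1_le θ t)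
  have hKint := lintegral_jap_rpow_lt_top (r := 1 + 2 * ε) (by linarith)
  set K := ∫⁻ x, ENNReal.ofReal (jap x ^ (-(1 + 2 * ε)))
  set B := ENNReal.ofReal (7 ^ (2 * ε)) *
    (4 * K * (∫⁻ t, G t) + 4 * K * (∫⁻ t, G t) + M * (2 * 2))
  have hB : B ≠ ∞ := by finiteness
  refine ⟨B.toReal, fun η N ↦ ?_⟩
  rw [ENNReal.ofReal_toReal hB]
  set W : ℝ → ℝ≥0∞ :=
    {x : ℝ | 1 ≤ |x|}.indicator (fun x ↦ ENNReal.ofReal (jap (N - x) ^ (-(2 * ε))))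
  have hW : Measurable W :=
    Measurable.indicator (by fun_prop) (measurableSet_le measurable_const (by fun_prop))
  set U : ℝ → ℝ≥0∞ := (Set.Ioo (-1) 1).indicator 1 with hU_def
  have hU : Measurable U := measurable_one.indicator measurableSet_Ioo
  have hUint : ∫⁻ x, U x = 2 := by
    rw [hU_def, lintegral_indicator_one measurableSet_Ioo, Real.volume_Ioo]
    norm_num
  rw [lintegral_prod_eq_shear (by fun_prop) N]
  calc
    _ ≤ ∫⁻ x, ∫⁻ y, ENNReal.ofReal (7 ^ (2 * ε)) * (G (η - 2 * x * y) * W x +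
        G (η - 2 * x * y) * W y + G (η - 2 * x * y) * (U x * U y)) := by
      refine lintegral_mono fun x ↦ lintegral_mono fun y ↦ ?_
      have h := multiplier_le hε0 N x y (norm_nonneg (ft1 θ (η - 2 * x * y)))
      convert h using 3
      · ring_nf
      · ring_nf
    _ = ENNReal.ofReal (7 ^ (2 * ε)) * ((∫⁻ x, ∫⁻ y, G (η - 2 * x * y) * W x) +
        (∫⁻ x, ∫⁻ y, G (η - 2 * x * y) * W y) +
        ∫⁻ x, ∫⁻ y, G (η - 2 * x * y) * (U x * U y)) := by
      rw [← lintegral_add_left (by fun_prop), ← lintegral_add_left (by fun_prop),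
        ← lintegral_const_mul _ (by fun_prop)]
      congr 1 with x
      rw [← lintegral_add_left (by fun_prop), ← lintegral_add_left (by fun_prop),
        ← lintegral_const_mul _ (by fun_prop)]
    _ ≤ B := by
      have h1 := lintegral_lintegral_outer_le hε0 hG η N
      have h2 : ∫⁻ x, ∫⁻ y, G (η - 2 * x * y) * W y ≤ 4 * K * ∫⁻ t, G t := by
        rw [lintegral_lintegral_swap (by fun_prop)]
        refine le_of_eq_of_le ?_ h1
        congr 1 with y
        congr 1 with x
        rw [mul_right_comm 2 x y]
      have h3 : ∫⁻ x, ∫⁻ y, G (η - 2 * x * y) * (U x * U y) ≤ M * (2 * 2) := by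
        calc
          _ ≤ ∫⁻ x, ∫⁻ y, M * (U x * U y) :=
            lintegral_mono fun x ↦ lintegral_mono fun y ↦ mul_le_mul' (hGM _) le_rfl
          _ = M * (2 * 2) := by
            have hinner (x : ℝ) : ∫⁻ y, M * (U x * U y) = M * (U x * 2) := by
              rw [lintegral_const_mul _ (by fun_prop), lintegral_const_mul _ hU, hUint]
            simp_rw [hinner]
            rw [lintegral_const_mul _ (by fun_prop), lintegral_mul_const _ hU, hUint]
      exact mul_le_mul' le_rfl (add_le_add (add_le_add h1 h2) h3)

end
end

section
/- Energy estimate for the focusing N-body Hamiltonian (Theorem 4.1, stated as a quadratic-form inequality on Schwartz functions): Fix ω ∈ ℝ, β ∈ (0,1), and an even real-valued Schwartz function V on ℝ, and set α = ‖V‖²_{L¹(ℝ)}. For every k ≥ 1 there exists N₀ = N₀(k) such that for all N ≥ max(N₀, k) and every symmetric Schwartz function ψ on ℝ^N with ‖ψ‖_{L²} = 1, one has Re ⟨ψ, (H_N + N α + N)^k ψ⟩ ≥ 2^{−k} N^k · Re ⟨ψ, S₁² S₂² ⋯ S_k² ψ⟩, where (H_N + N α + N)^k ψ denotes the k-fold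 application of the operator H_N + (Nα+N)·Id to ψ. -/
open MeasureTheory Complex
open scoped BigOperators

noncomputable section

/-- Second partial derivative `∂²_{x_j} ψ` of a function of `N` real variables. -/
def d2 {N : ℕ} (j : Fin N) (ψ : (Fin N → ℝ) → ℂ) : (Fin N → ℝ) → ℂ :=
  fun x => iteratedDeriv 2 (fun t => ψ (Function.update x j t)) (x j)

/-- The one-particle operator `S_j² ψ = ψ - ½ ∂²_{x_j} ψ + ½ ω² x_j² ψ`. -/
def Ssq {N : ℕ} (ω : ℝ) (j : Fin N) (ψ : (Fin N → ℝ) → ℂ) : (Fin N → ℝ) → ℂ :=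
  fun x => ψ x - (1/2 : ℂ) * d2 j ψ x + (1/2 : ℂ) * (ω : ℂ) ^ 2 * ((x j : ℝ) : ℂ) ^ 2 * ψ x

/-- The `N`-body Hamiltonian
`H_N ψ = Σ_j (-½ ∂²_{x_j} ψ + ½ ω² x_j² ψ)
  + (1/N) Σ_{i<j} N^β V(N^β (x_i - x_j)) ψ`. -/
def HamN (ω β : ℝ) (V : ℝ → ℝ) (N : ℕ) (ψ : (Fin N → ℝ) → ℂ) : (Fin N → ℝ) → ℂ :=
  fun x =>
    (∑ j : Fin N, (-(1/2 : ℂ) * d2 j ψ x + (1/2 : ℂ) * (ω : ℂ) ^ 2 * ((x j : ℝ) : ℂ) ^ 2 * ψ x))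
    + ((N : ℂ))⁻¹ * ∑ p : Fin N × Fin N,
        if p.1 < p.2 then
          (((N : ℝ) ^ β * V ((N : ℝ) ^ β * (x p.1 - x p.2)) : ℝ) : ℂ) * ψ x
        else 0

/-- `H_N + c·Id`. -/
def HamPlus (ω β : ℝ) (V : ℝ → ℝ) (N : ℕ) (c : ℝ) (ψ : (Fin N → ℝ) → ℂ) :
    (Fin N → ℝ) → ℂ :=
  fun x => HamN ω β V N ψ x + (c : ℂ) * ψ x

/-- The product `S₁² S₂² ⋯ S_k²` (composition of the pairwise commuting operators `S_j²`
for the first `k` coordinates). -/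
def Sprod (ω : ℝ) (N : ℕ) : ℕ → ((Fin N → ℝ) → ℂ) → ((Fin N → ℝ) → ℂ)
  | 0, ψ => ψ
  | (k+1), ψ => if h : k < N then Ssq ω ⟨k, h⟩ (Sprod ω N k ψ) else Sprod ω N k ψ

/-- The real part of the `L²(ℝ^N)` inner product `⟨ψ, f⟩ = ∫ conj(ψ) f`. -/
def reInner {N : ℕ} (ψ f : (Fin N → ℝ) → ℂ) : ℝ :=
  (∫ x : Fin N → ℝ, (starRingEnd ℂ) (ψ x) * f x).re

/-- A function of `N` variables is symmetric if it is invariant under permutations of its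
arguments. -/
def IsSymmetricFn {N : ℕ} (ψ : (Fin N → ℝ) → ℂ) : Prop :=
  ∀ (σ : Equiv.Perm (Fin N)) (x : Fin N → ℝ), ψ (x ∘ σ) = ψ x

open scoped SchwartzMap LineDeriv

/-- The real inner product `Re ⟨f, g⟩` of two Schwartz functions. -/
def realInner {N : ℕ} (f g : 𝓢(Fin N → ℝ, ℂ)) : ℝ :=
  ∫ x, inner ℝ (f x) (g x)

section realInner

variable {N : ℕ} (f g h : 𝓢(Fin N → ℝ, ℂ))

lemma integrable_inner_schwartz : Integrable fun x => inner ℝ (f x) (g x) :=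
  (SchwartzMap.pairing (innerSL ℝ : ℂ →L[ℝ] ℂ →L[ℝ] ℝ) f g).integrable

lemma integrable_norm_sq_schwartz : Integrable fun x => ‖f x‖ ^ 2 := by
  simpa using integrable_inner_schwartz f f

lemma reInner_eq_realInner : reInner f g = realInner f g := by
  have hint : Integrable fun x => (starRingEnd ℂ) (f x) * g x := by
    have := (f.memLp 2).integrable_mul (q := 2) (g.memLp 2)
    refine (this.norm).mono' ?_ ?_
    · exact (Complex.continuous_conj.comp f.continuous).mul g.continuous |>.aestronglyMeasurable
    · exact Filter.Eventually.of_forall fun x => by simp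
  have := integral_re (𝕜 := ℂ) hint
  simp only [reInner, realInner, Complex.inner]
  simp only [mul_comm (g _)]
  exact this.symm

lemma realInner_comm : realInner f g = realInner g f := by
  simp only [realInner, real_inner_comm]

lemma realInner_add_right : realInner f (g + h) = realInner f g + realInner f h := by
  simp only [realInner, add_apply, inner_add_right]
  exact integral_add (integrable_inner_schwartz f g) (integrable_inner_schwartz f h)

lemma realInner_smul_right (c : ℝ) : realInner f (c • g) = c * realInner f g := by
  simp only [realInner, smul_apply, inner_smul_right]
  exact integral_const_mul _ _

/-- `realInner` as a linear functional of the second argument. -/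
def realInnerRight : 𝓢(Fin N → ℝ, ℂ) →ₗ[ℝ] ℝ where
  toFun := realInner f
  map_add' := realInner_add_right f
  map_smul' c g := realInner_smul_right f g c

lemma realInner_neg_right : realInner f (-g) = -realInner f g :=
  map_neg (realInnerRight f) g

lemma realInner_sub_right : realInner f (g - h) = realInner f g - realInner f h :=
  map_sub (realInnerRight f) g h

lemma realInner_sum_right {ι : Type*} (s : Finset ι) (F : ι → 𝓢(Fin N → ℝ, ℂ)) :
    realInner f (∑ i ∈ s, F i) = ∑ i ∈ s, realInner f (F i) :=
  map_sum (realInnerRight f) F s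

lemma realInner_self : realInner f f = ∫ x, ‖f x‖ ^ 2 := by
  simp [realInner]

lemma realInner_self_nonneg : 0 ≤ realInner f f := by
  rw [realInner_self]; positivity

lemma realInner_sub_left : realInner (f - g) h = realInner f h - realInner g h := by
  simp only [realInner_comm _ h, realInner_sub_right]

lemma realInner_add_left : realInner (f + g) h = realInner f h + realInner g h := by
  simp only [realInner_comm _ h, realInner_add_right]

lemma realInner_smul_left (c : ℝ) : realInner (c • f) g = c * realInner f g := by
  simp only [realInner_comm _ g, realInner_smul_right]

lemma realInner_sum_left {ι : Type*} (s : Finset ι) (F : ι → 𝓢(Fin N → ℝ, ℂ)) :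
    realInner (∑ i ∈ s, F i) f = ∑ i ∈ s, realInner (F i) f := by
  simp only [realInner_comm _ f, realInner_sum_right]

end realInner

/-- The operators on Schwartz space, as a ring. -/
abbrev SchwartzOp (N : ℕ) := Module.End ℝ 𝓢(Fin N → ℝ, ℂ)

section operators

variable {N : ℕ}

/-- The partial derivative `∂_j`. -/
def partialOp (j : Fin N) : SchwartzOp N :=
  (LineDeriv.lineDerivOpCLM ℝ 𝓢(Fin N → ℝ, ℂ) (Pi.single j 1 : Fin N → ℝ)).toLinearMap

/-- Multiplication by a real function (of temperate growth). -/
def mulOp (u : (Fin N → ℝ) → ℝ) : SchwartzOp N :=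
  (SchwartzMap.smulLeftCLM ℂ u).toLinearMap

/-- Multiplication by the coordinate `x_j`. -/
def coordOp (j : Fin N) : SchwartzOp N := mulOp fun x => x j

/-- Multiplication by `W (x_i - x_j)`. -/
def pairOp (W : 𝓢(ℝ, ℝ)) (i j : Fin N) : SchwartzOp N := mulOp fun x => W (x i - x j)

lemma partialOp_apply (j : Fin N) (f : 𝓢(Fin N → ℝ, ℂ)) (x : Fin N → ℝ) :
    partialOp j f x = fderiv ℝ f x (Pi.single j 1) := rfl

lemma mulOp_apply {u : (Fin N → ℝ) → ℝ} (hu : u.HasTemperateGrowth) (f : 𝓢(Fin N → ℝ, ℂ))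
    (x : Fin N → ℝ) : mulOp u f x = u x * f x := by
  simp [mulOp, SchwartzMap.smulLeftCLM_apply_apply hu]

lemma hasTemperateGrowth_coord (j : Fin N) :
    Function.HasTemperateGrowth fun x : Fin N → ℝ => x j :=
  (ContinuousLinearMap.proj (R := ℝ) (φ := fun _ : Fin N => ℝ) j).hasTemperateGrowth

lemma hasTemperateGrowth_pair (W : 𝓢(ℝ, ℝ)) (i j : Fin N) :
    Function.HasTemperateGrowth fun x : Fin N → ℝ => W (x i - x j) :=
  W.hasTemperateGrowth.comp ((hasTemperateGrowth_coord i).sub (hasTemperateGrowth_coord j))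

lemma coordOp_apply (j : Fin N) (f : 𝓢(Fin N → ℝ, ℂ)) (x : Fin N → ℝ) :
    coordOp j f x = x j * f x :=
  mulOp_apply (hasTemperateGrowth_coord j) f x

lemma pairOp_apply (W : 𝓢(ℝ, ℝ)) (i j : Fin N) (f : 𝓢(Fin N → ℝ, ℂ)) (x : Fin N → ℝ) :
    pairOp W i j f x = W (x i - x j) * f x :=
  mulOp_apply (hasTemperateGrowth_pair W i j) f x

lemma realInner_mulOp_left {u : (Fin N → ℝ) → ℝ} (hu : u.HasTemperateGrowth)
    (f g : 𝓢(Fin N → ℝ, ℂ)) : realInner (mulOp u f) g = realInner f (mulOp u g) := by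
  simp only [realInner, mulOp_apply hu]
  congr with x
  simp only [Complex.inner, map_mul, conj_ofReal]
  congr 1; ring

lemma realInner_coordOp_left (j : Fin N) (f g : 𝓢(Fin N → ℝ, ℂ)) :
    realInner (coordOp j f) g = realInner f (coordOp j g) :=
  realInner_mulOp_left (hasTemperateGrowth_coord j) f g

lemma realInner_pairOp_left (W : 𝓢(ℝ, ℝ)) (i j : Fin N) (f g : 𝓢(Fin N → ℝ, ℂ)) :
    realInner (pairOp W i j f) g = realInner f (pairOp W i j g) :=
  realInner_mulOp_left (hasTemperateGrowth_pair W i j) f g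

lemma realInner_partialOp_left (j : Fin N) (f g : 𝓢(Fin N → ℝ, ℂ)) :
    realInner (partialOp j f) g = -realInner f (partialOp j g) := by
  have := SchwartzMap.integral_bilinear_lineDerivOp_right_eq_neg_left (μ := volume) f g
    (innerSL ℝ : ℂ →L[ℝ] ℂ →L[ℝ] ℝ) (Pi.single j 1 : Fin N → ℝ)
  rw [realInner, realInner, eq_neg_iff_add_eq_zero, add_comm, ← eq_neg_iff_add_eq_zero]
  exact this

lemma commute_mulOp {u v : (Fin N → ℝ) → ℝ} (hu : u.HasTemperateGrowth)
    (hv : v.HasTemperateGrowth) : Commute (mulOp u) (mulOp v) := by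
  refine LinearMap.ext fun f => SchwartzMap.ext fun x => ?_
  simp only [Module.End.mul_apply, mulOp_apply hu, mulOp_apply hv]
  ring

lemma commute_partialOp (i j : Fin N) : Commute (partialOp i) (partialOp j) := by
  refine LinearMap.ext fun f => SchwartzMap.ext fun x => ?_
  have h : ContDiff ℝ 2 f := f.smooth 2
  have hd : Differentiable ℝ (fderiv ℝ f) :=
    (h.fderiv_right (m := 1) (by norm_num)).differentiable (by norm_num)
  have key (a b : Fin N) : partialOp a (partialOp b f) x
      = fderiv ℝ (fderiv ℝ f) x (Pi.single a 1) (Pi.single b 1) := by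
    rw [partialOp_apply]
    change fderiv ℝ (fun y => fderiv ℝ f y (Pi.single b 1)) x (Pi.single a 1) = _
    rw [fderiv_clm_apply (hd x) (by fun_prop)]
    simp
  simp only [Module.End.mul_apply, key]
  exact (h.contDiffAt.isSymmSndFDerivAt (by simp)).eq _ _

lemma partialOp_mulOp {u v : (Fin N → ℝ) → ℝ} (hu : u.HasTemperateGrowth)
    (hv : v.HasTemperateGrowth) (j : Fin N)
    (h : ∀ x, fderiv ℝ u x (Pi.single j 1) = v x) :
    partialOp j * mulOp u = mulOp u * partialOp j + mulOp v := by
  refine LinearMap.ext fun f => SchwartzMap.ext fun x => ?_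
  have hd : DifferentiableAt ℝ u x := (hu.1.differentiable (by simp)) x
  have hcoe : (mulOp u f : (Fin N → ℝ) → ℂ) = fun y => u y • f y := by
    ext y; simp [mulOp_apply hu]
  simp only [Module.End.mul_apply, LinearMap.add_apply, add_apply, mulOp_apply hu,
    mulOp_apply hv, partialOp_apply, hcoe]
  rw [fderiv_fun_smul hd f.differentiableAt]
  simp [h]

lemma commute_partialOp_coordOp {i j : Fin N} (hij : i ≠ j) :
    Commute (partialOp i) (coordOp j) := by
  have := partialOp_mulOp (hasTemperateGrowth_coord j) (.const 0) i (fun x => by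
    rw [show (fun x : Fin N → ℝ => x j) =
      ⇑(ContinuousLinearMap.proj (R := ℝ) (φ := fun _ : Fin N => ℝ) j) from rfl,
      ContinuousLinearMap.fderiv]
    simp [hij.symm])
  have h0 : mulOp (fun _ : Fin N → ℝ => (0 : ℝ)) = 0 := by
    refine LinearMap.ext fun f => SchwartzMap.ext fun x => ?_
    simp [mulOp_apply (.const (0 : ℝ))]
  rwa [h0, add_zero] at this

lemma commute_coordOp (i j : Fin N) : Commute (coordOp i) (coordOp j) :=
  commute_mulOp (hasTemperateGrowth_coord i) (hasTemperateGrowth_coord j)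

lemma commute_coordOp_pairOp (W : 𝓢(ℝ, ℝ)) (i j m : Fin N) :
    Commute (coordOp m) (pairOp W i j) :=
  commute_mulOp (hasTemperateGrowth_coord m) (hasTemperateGrowth_pair W i j)

/-- The derivative of a real Schwartz function. -/
abbrev schwartzDeriv (W : 𝓢(ℝ, ℝ)) : 𝓢(ℝ, ℝ) := SchwartzMap.derivCLM ℝ ℝ W

lemma fderiv_pair (W : 𝓢(ℝ, ℝ)) (i j : Fin N) (x v : Fin N → ℝ) :
    fderiv ℝ (fun x : Fin N → ℝ => W (x i - x j)) x v
      = schwartzDeriv W (x i - x j) * (v i - v j) := by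
  have h1 : HasFDerivAt (fun x : Fin N → ℝ => x i - x j)
      (ContinuousLinearMap.proj (R := ℝ) (φ := fun _ : Fin N => ℝ) i -
        ContinuousLinearMap.proj (R := ℝ) (φ := fun _ : Fin N => ℝ) j) x :=
    (hasFDerivAt_apply i x).sub (hasFDerivAt_apply j x)
  have h2 : HasFDerivAt (fun x : Fin N → ℝ => W (x i - x j)) _ x :=
    (W.hasDerivAt (x i - x j)).comp_hasFDerivAt x h1
  rw [h2.fderiv]
  simp

lemma commute_partialOp_pairOp (W : 𝓢(ℝ, ℝ)) {i j m : Fin N} (hi : m ≠ i) (hj : m ≠ j) :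
    Commute (partialOp m) (pairOp W i j) := by
  have := partialOp_mulOp (hasTemperateGrowth_pair W i j) (.const 0) m (fun x => by
    simp [fderiv_pair, hi.symm, hj.symm])
  have h0 : mulOp (fun _ : Fin N → ℝ => (0 : ℝ)) = 0 := by
    refine LinearMap.ext fun f => SchwartzMap.ext fun x => ?_
    simp [mulOp_apply (.const (0 : ℝ))]
  rwa [h0, add_zero] at this

lemma partialOp_mul_pairOp_left (W : 𝓢(ℝ, ℝ)) {i j : Fin N} (hij : i ≠ j) :
    partialOp i * pairOp W i j = pairOp W i j * partialOp i + pairOp (schwartzDeriv W) i j :=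
  partialOp_mulOp (hasTemperateGrowth_pair W i j) (hasTemperateGrowth_pair _ i j) i
    (fun x => by simp only [fderiv_pair]; simp [hij])

lemma partialOp_mul_pairOp_right (W : 𝓢(ℝ, ℝ)) {i j : Fin N} (hij : i ≠ j) :
    partialOp j * pairOp W i j = pairOp W i j * partialOp j - pairOp (schwartzDeriv W) i j := by
  have hneg : pairOp (-schwartzDeriv W) i j = -pairOp (schwartzDeriv W) i j := by
    refine LinearMap.ext fun f => SchwartzMap.ext fun x => ?_
    simp [pairOp_apply]
  rw [sub_eq_add_neg, ← hneg]
  exact partialOp_mulOp (hasTemperateGrowth_pair W i j) (hasTemperateGrowth_pair _ i j) j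
    (fun x => by simp only [fderiv_pair]; simp [hij])

end operators

section sobolev

/-- A bounded primitive of an integrable nonnegative function. -/
lemma exists_primitive_abs_le {W : ℝ → ℝ} (hc : Continuous W) (hi : Integrable W)
    (h0 : ∀ s, 0 ≤ W s) :
    ∃ G : ℝ → ℝ, (∀ s, HasDerivAt G (W s) s) ∧ ∀ s, |G s| ≤ (∫ s, W s) / 2 := by
  refine ⟨fun s => (∫ u in Set.Iic s, W u) - (∫ u, W u) / 2, fun s => ?_, fun s => ?_⟩
  · have h : (fun s => (∫ u in Set.Iic s, W u) - (∫ u, W u) / 2)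
        = fun s => (∫ u in (0 : ℝ)..s, W u) + ((∫ u in Set.Iic 0, W u) - (∫ u, W u) / 2) := by
      ext s
      rw [← intervalIntegral.integral_Iic_sub_Iic hi.integrableOn hi.integrableOn]
      ring
    rw [h]
    exact (hc.integral_hasStrictDerivAt 0 s).hasDerivAt.add_const _
  · have h1 : 0 ≤ ∫ u in Set.Iic s, W u := integral_nonneg h0
    have h2 : (∫ u in Set.Iic s, W u) ≤ ∫ u, W u :=
      setIntegral_le_integral hi (Filter.Eventually.of_forall h0)
    rw [abs_le]
    constructor <;> linarith

variable {N : ℕ}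

lemma integrable_weight_mul_norm_sq {W : ℝ → ℝ} (hc : Continuous W) {C : ℝ}
    (hC : ∀ s, |W s| ≤ C) (i j : Fin N) (f : 𝓢(Fin N → ℝ, ℂ)) :
    Integrable fun x => W (x i - x j) * ‖f x‖ ^ 2 :=
  (integrable_norm_sq_schwartz f).bdd_mul (c := C)
    (Continuous.aestronglyMeasurable (by fun_prop)) (Filter.Eventually.of_forall fun x => hC _)

lemma hasLineDerivAt_norm_sq (f : 𝓢(Fin N → ℝ, ℂ)) (j : Fin N) (x : Fin N → ℝ) :
    HasLineDerivAt ℝ (fun x => ‖f x‖ ^ 2) (2 * inner ℝ (f x) (partialOp j f x)) x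
      (Pi.single j 1) := by
  have h : (2 : ℝ) * inner ℝ (f x) (partialOp j f x)
      = (2 • (innerSL ℝ (f x)).comp (fderiv ℝ f x)) (Pi.single j 1) := by
    rw [two_smul, two_mul]
    rfl
  rw [h]
  exact (f.hasFDerivAt x).norm_sq.hasLineDerivAt (Pi.single j 1)

/-- One-dimensional Sobolev inequality in the variable `x_j`, integrated against a weight depending
on `x_i - x_j`. -/
lemma integral_weight_mul_norm_sq_le {W : ℝ → ℝ} (hc : Continuous W) (hi : Integrable W)
    (h0 : ∀ s, 0 ≤ W s) {C : ℝ} (hC : ∀ s, |W s| ≤ C) {i j : Fin N} (hij : i ≠ j)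
    (f : 𝓢(Fin N → ℝ, ℂ)) {t : ℝ} (ht : 0 < t) :
    ∫ x, W (x i - x j) * ‖f x‖ ^ 2 ≤ (∫ s, W s) *
      (t * realInner f f + (4 * t)⁻¹ * realInner (partialOp j f) (partialOp j f)) := by
  obtain ⟨G, hG, hGb⟩ := exists_primitive_abs_le hc hi h0
  have hGc : Continuous G := continuous_iff_continuousAt.2 fun s => (hG s).continuousAt
  have hI : 0 ≤ ∫ s, W s := integral_nonneg h0
  have hGm : AEStronglyMeasurable (fun x : Fin N → ℝ => G (x i - x j)) :=
    Continuous.aestronglyMeasurable (by fun_prop)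
  have hGb' : ∀ᵐ x : Fin N → ℝ, ‖G (x i - x j)‖ ≤ (∫ s, W s) / 2 :=
    Filter.Eventually.of_forall fun x => hGb _
  have hint1 := integrable_weight_mul_norm_sq hc hC i j f
  have hint2 : Integrable fun x => G (x i - x j) * (2 * inner ℝ (f x) (partialOp j f x)) :=
    ((integrable_inner_schwartz f (partialOp j f)).const_mul 2).bdd_mul hGm hGb'
  have hint3 : Integrable fun x => G (x i - x j) * ‖f x‖ ^ 2 :=
    (integrable_norm_sq_schwartz f).bdd_mul hGm hGb'
  have hGd (x : Fin N → ℝ) : HasLineDerivAt ℝ (fun x : Fin N → ℝ => G (x i - x j))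
      (-W (x i - x j)) x (Pi.single j 1) := by
    have h1 : HasFDerivAt (fun x : Fin N → ℝ => x i - x j)
        (ContinuousLinearMap.proj (R := ℝ) (φ := fun _ : Fin N => ℝ) i -
          ContinuousLinearMap.proj (R := ℝ) (φ := fun _ : Fin N => ℝ) j) x :=
      (hasFDerivAt_apply i x).sub (hasFDerivAt_apply j x)
    have h2 : HasFDerivAt (fun x : Fin N → ℝ => G (x i - x j)) _ x :=
      (hG (x i - x j)).comp_hasFDerivAt x h1
    simpa [hij] using h2.hasLineDerivAt (Pi.single j 1)
  have hparts := integral_bilinear_hasLineDerivAt_right_eq_neg_left_of_integrable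
    (μ := (volume : Measure (Fin N → ℝ))) (B := ContinuousLinearMap.mul ℝ ℝ)
    (f := fun x => G (x i - x j)) (f' := fun x => -W (x i - x j))
    (g := fun x => ‖f x‖ ^ 2) (g' := fun x => 2 * inner ℝ (f x) (partialOp j f x))
    (v := Pi.single j 1) (by simpa using hint1.neg) (by simpa using hint2) (by simpa using hint3)
    (fun x _ => hGd x) (fun x _ => hasLineDerivAt_norm_sq f j x)
  simp only [ContinuousLinearMap.mul_apply', neg_mul, integral_neg, neg_neg] at hparts
  rw [← hparts, realInner_self, realInner_self, ← integral_const_mul, ← integral_const_mul,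
    ← integral_add ((integrable_norm_sq_schwartz _).const_mul _)
      ((integrable_norm_sq_schwartz _).const_mul _), ← integral_const_mul]
  refine integral_mono hint2 ((((integrable_norm_sq_schwartz _).const_mul _).add
    ((integrable_norm_sq_schwartz _).const_mul _)).const_mul _) fun x => ?_
  set a := ‖f x‖
  set b := ‖partialOp j f x‖
  have h1 : |2 * inner ℝ (f x) (partialOp j f x)| ≤ 2 * (a * b) := by
    rw [abs_mul, abs_two]
    gcongr
    exact abs_real_inner_le_norm _ _
  have h2 : a * b ≤ t * a ^ 2 + (4 * t)⁻¹ * b ^ 2 := by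
    have : 0 ≤ (4 * t)⁻¹ * (2 * t * a - b) ^ 2 := by positivity
    have h3 : (4 * t)⁻¹ * (2 * t * a - b) ^ 2 = t * a ^ 2 + (4 * t)⁻¹ * b ^ 2 - a * b := by
      field_simp; ring
    linarith
  calc G (x i - x j) * (2 * inner ℝ (f x) (partialOp j f x))
      ≤ |G (x i - x j)| * |2 * inner ℝ (f x) (partialOp j f x)| := by
        rw [← abs_mul]; exact le_abs_self _
    _ ≤ (∫ s, W s) / 2 * (2 * (a * b)) := by gcongr; exact hGb _
    _ = (∫ s, W s) * (a * b) := by ring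
    _ ≤ _ := by gcongr

lemma exists_abs_schwartz_le (W : 𝓢(ℝ, ℝ)) : ∃ C, 0 ≤ C ∧ ∀ s, |W s| ≤ C :=
  ⟨SchwartzMap.seminorm ℝ 0 0 W, apply_nonneg _ _, fun s => W.norm_le_seminorm ℝ s⟩

lemma integral_abs_weight_mul_norm_sq_le (W : 𝓢(ℝ, ℝ)) {i j : Fin N} (hij : i ≠ j)
    (f : 𝓢(Fin N → ℝ, ℂ)) {t : ℝ} (ht : 0 < t) :
    ∫ x, |W (x i - x j)| * ‖f x‖ ^ 2 ≤ (∫ s, |W s|) *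
      (t * realInner f f + (4 * t)⁻¹ * realInner (partialOp j f) (partialOp j f)) := by
  obtain ⟨C, -, hC⟩ := exists_abs_schwartz_le W
  exact integral_weight_mul_norm_sq_le W.continuous.abs W.integrable.norm (fun s => abs_nonneg _)
    (fun s => by simpa using hC s) hij f ht

lemma realInner_pairOp_self_le (W : 𝓢(ℝ, ℝ)) {i j : Fin N} (hij : i ≠ j)
    (f : 𝓢(Fin N → ℝ, ℂ)) {t : ℝ} (ht : 0 < t) :
    realInner (pairOp W i j f) (pairOp W i j f) ≤ (∫ s, W s ^ 2) *
      (t * realInner f f + (4 * t)⁻¹ * realInner (partialOp j f) (partialOp j f)) := by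
  obtain ⟨C, hC0, hC⟩ := exists_abs_schwartz_le W
  rw [realInner_self]
  convert integral_weight_mul_norm_sq_le (W := fun s => W s ^ 2) (W.continuous.pow 2) ?_
    (fun s => sq_nonneg _) (C := C ^ 2) (fun s => ?_) hij f ht using 3 with x
  · rw [pairOp_apply, norm_mul, mul_pow]
    simp
  · simpa using (W.memLp 2).integrable_sq
  · rw [abs_pow]; exact pow_le_pow_left₀ (abs_nonneg _) (hC s) 2

lemma abs_realInner_pairOp_le (W : 𝓢(ℝ, ℝ)) (i j : Fin N) (f g : 𝓢(Fin N → ℝ, ℂ)) :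
    |realInner f (pairOp W i j g)| ≤
      ((∫ x, |W (x i - x j)| * ‖f x‖ ^ 2) + ∫ x, |W (x i - x j)| * ‖g x‖ ^ 2) / 2 := by
  obtain ⟨C, -, hC⟩ := exists_abs_schwartz_le W
  have h (f : 𝓢(Fin N → ℝ, ℂ)) := integrable_weight_mul_norm_sq W.continuous.abs (C := C)
    (fun s => by simpa using hC s) i j f
  rw [realInner, ← integral_add (h f) (h g), ← integral_div]
  refine abs_integral_le_integral_abs.trans (integral_mono
    (integrable_inner_schwartz _ _).norm (((h f).add (h g)).div_const 2) fun x => ?_)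
  have h1 := abs_real_inner_le_norm (f x) (pairOp W i j g x)
  have h2 : ‖pairOp W i j g x‖ = |W (x i - x j)| * ‖g x‖ := by simp [pairOp_apply]
  rw [h2] at h1
  refine h1.trans ?_
  have := mul_nonneg (abs_nonneg (W (x i - x j))) (sq_nonneg (‖f x‖ - ‖g x‖))
  nlinarith

lemma abs_realInner_pairOp_le_of_bound {W : 𝓢(ℝ, ℝ)} {C : ℝ} (hC : ∀ s, |W s| ≤ C)
    (i j : Fin N) (f g : 𝓢(Fin N → ℝ, ℂ)) :
    |realInner f (pairOp W i j g)| ≤ C * ((realInner f f + realInner g g) / 2) := by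
  refine (abs_realInner_pairOp_le W i j f g).trans ?_
  have h (f : 𝓢(Fin N → ℝ, ℂ)) :
      ∫ x, |W (x i - x j)| * ‖f x‖ ^ 2 ≤ C * realInner f f := by
    rw [realInner_self, ← integral_const_mul]
    refine integral_mono (integrable_weight_mul_norm_sq W.continuous.abs (C := C)
      (fun s => by simpa using hC s) i j f) ((integrable_norm_sq_schwartz f).const_mul C)
      fun x => ?_
    have := hC (x i - x j)
    gcongr
  linarith [h f, h g]

lemma abs_realInner_le_add (f g : 𝓢(Fin N → ℝ, ℂ)) {d : ℝ} (hd : 0 < d) :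
    |realInner f g| ≤ (d * realInner f f + d⁻¹ * realInner g g) / 2 := by
  have h1 := realInner_self_nonneg (d • f - g)
  have h2 := realInner_self_nonneg (d • f + g)
  simp only [realInner_sub_left, realInner_sub_right, realInner_smul_left, realInner_smul_right,
    realInner_add_left, realInner_add_right, realInner_comm g f] at h1 h2
  have h3 : 0 ≤ d⁻¹ * (d * (d * realInner f f) - d * realInner f g
      - (d * realInner f g - realInner g g)) := mul_nonneg (by positivity) (by linarith)
  have h4 : 0 ≤ d⁻¹ * (d * (d * realInner f f) + d * realInner f g
      + (d * realInner f g + realInner g g)) := mul_nonneg (by positivity) (by linarith)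
  have e3 : d⁻¹ * (d * (d * realInner f f) - d * realInner f g
      - (d * realInner f g - realInner g g)) =
      d * realInner f f + d⁻¹ * realInner g g - 2 * realInner f g := by field_simp; ring
  have e4 : d⁻¹ * (d * (d * realInner f f) + d * realInner f g
      + (d * realInner f g + realInner g g)) =
      d * realInner f f + d⁻¹ * realInner g g + 2 * realInner f g := by field_simp; ring
  rw [e3] at h3
  rw [e4] at h4
  rw [abs_le]
  constructor <;> linarith

end sobolev

section oneBody

variable {N : ℕ}

/-- The one-particle operator `S_j²` on Schwartz space. -/
def oneBodyOp (ω : ℝ) (j : Fin N) : SchwartzOp N :=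
  1 - (1 / 2 : ℝ) • (partialOp j * partialOp j) + (ω ^ 2 / 2) • (coordOp j * coordOp j)

/-- `A` commutes with differentiation and multiplication by the coordinate in the variable `m`. -/
def CommutesAt (m : Fin N) (A : SchwartzOp N) : Prop :=
  Commute (partialOp m) A ∧ Commute (coordOp m) A

namespace CommutesAt

variable {m : Fin N} {A B : SchwartzOp N}

protected lemma one : CommutesAt m (1 : SchwartzOp N) :=
  ⟨Commute.one_right _, Commute.one_right _⟩

protected lemma zero : CommutesAt m (0 : SchwartzOp N) :=
  ⟨Commute.zero_right _, Commute.zero_right _⟩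

protected lemma mul (hA : CommutesAt m A) (hB : CommutesAt m B) : CommutesAt m (A * B) :=
  ⟨hA.1.mul_right hB.1, hA.2.mul_right hB.2⟩

protected lemma add (hA : CommutesAt m A) (hB : CommutesAt m B) : CommutesAt m (A + B) :=
  ⟨hA.1.add_right hB.1, hA.2.add_right hB.2⟩

protected lemma sub (hA : CommutesAt m A) (hB : CommutesAt m B) : CommutesAt m (A - B) :=
  ⟨hA.1.sub_right hB.1, hA.2.sub_right hB.2⟩

protected lemma neg (hA : CommutesAt m A) : CommutesAt m (-A) :=
  ⟨hA.1.neg_right, hA.2.neg_right⟩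

protected lemma smul (hA : CommutesAt m A) (c : ℝ) : CommutesAt m (c • A) :=
  ⟨hA.1.smul_right c, hA.2.smul_right c⟩

lemma commute_oneBodyOp (hA : CommutesAt m A) (ω : ℝ) : Commute (oneBodyOp ω m) A :=
  ((Commute.one_left A).sub_left ((hA.1.mul_left hA.1).smul_left _)).add_left
    ((hA.2.mul_left hA.2).smul_left _)

protected lemma pairOp (W : 𝓢(ℝ, ℝ)) {i j : Fin N} (hi : m ≠ i) (hj : m ≠ j) :
    CommutesAt m (pairOp W i j) :=
  ⟨commute_partialOp_pairOp W hi hj, commute_coordOp_pairOp W i j m⟩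

protected lemma oneBodyOp (ω : ℝ) {j : Fin N} (hj : m ≠ j) : CommutesAt m (oneBodyOp ω j) := by
  have hP : CommutesAt m (partialOp j) :=
    ⟨commute_partialOp m j, (commute_partialOp_coordOp hj.symm).symm⟩
  have hX : CommutesAt m (coordOp j) := ⟨commute_partialOp_coordOp hj, commute_coordOp m j⟩
  exact (CommutesAt.one.sub ((hP.mul hP).smul _)).add ((hX.mul hX).smul _)

end CommutesAt

lemma commute_oneBodyOp_oneBodyOp (ω : ℝ) (i j : Fin N) :
    Commute (oneBodyOp ω i) (oneBodyOp ω j) := by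
  by_cases h : i = j
  · subst h; exact Commute.refl _
  · exact (CommutesAt.oneBodyOp ω h).commute_oneBodyOp ω

lemma realInner_oneBodyOp_expand (ω : ℝ) (j : Fin N) (f g : 𝓢(Fin N → ℝ, ℂ)) :
    realInner f (oneBodyOp ω j g) = realInner f g
      + (1 / 2) * realInner (partialOp j f) (partialOp j g)
      + (ω ^ 2 / 2) * realInner (coordOp j f) (coordOp j g) := by
  simp only [oneBodyOp, LinearMap.add_apply, LinearMap.sub_apply, LinearMap.smul_apply,
    Module.End.one_apply, Module.End.mul_apply, realInner_add_right, realInner_sub_right,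
    realInner_smul_right, realInner_partialOp_left, realInner_coordOp_left]
  ring

lemma realInner_oneBodyOp_left (ω : ℝ) (j : Fin N) (f g : 𝓢(Fin N → ℝ, ℂ)) :
    realInner (oneBodyOp ω j f) g = realInner f (oneBodyOp ω j g) := by
  rw [realInner_comm, realInner_oneBodyOp_expand, realInner_oneBodyOp_expand, realInner_comm f,
    realInner_comm (partialOp j f), realInner_comm (coordOp j f)]

/-- The quadratic form `Re ⟨f, A f⟩`. -/
def quadForm (A : SchwartzOp N) (f : 𝓢(Fin N → ℝ, ℂ)) : ℝ := realInner f (A f)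

lemma quadForm_one (f : 𝓢(Fin N → ℝ, ℂ)) : quadForm 1 f = realInner f f := rfl

lemma quadForm_zero (f : 𝓢(Fin N → ℝ, ℂ)) : quadForm 0 f = 0 :=
  map_zero (realInnerRight f)

lemma quadForm_add (A B : SchwartzOp N) (f : 𝓢(Fin N → ℝ, ℂ)) :
    quadForm (A + B) f = quadForm A f + quadForm B f := realInner_add_right _ _ _

lemma quadForm_neg (A : SchwartzOp N) (f : 𝓢(Fin N → ℝ, ℂ)) :
    quadForm (-A) f = -quadForm A f := realInner_neg_right _ _

lemma quadForm_smul (c : ℝ) (A : SchwartzOp N) (f : 𝓢(Fin N → ℝ, ℂ)) :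
    quadForm (c • A) f = c * quadForm A f := realInner_smul_right _ _ _

lemma quadForm_sum {ι : Type*} (s : Finset ι) (A : ι → SchwartzOp N) (f : 𝓢(Fin N → ℝ, ℂ)) :
    quadForm (∑ i ∈ s, A i) f = ∑ i ∈ s, quadForm (A i) f := by
  simp only [quadForm, LinearMap.sum_apply, realInner_sum_right]

lemma quadForm_oneBodyOp (ω : ℝ) (j : Fin N) (f : 𝓢(Fin N → ℝ, ℂ)) :
    quadForm (oneBodyOp ω j) f = realInner f f
      + (1 / 2) * realInner (partialOp j f) (partialOp j f)
      + (ω ^ 2 / 2) * realInner (coordOp j f) (coordOp j f) :=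
  realInner_oneBodyOp_expand ω j f f

lemma quadForm_oneBodyOp_mul (ω : ℝ) {m : Fin N} {A : SchwartzOp N} (hA : CommutesAt m A)
    (f : 𝓢(Fin N → ℝ, ℂ)) :
    quadForm (oneBodyOp ω m * A) f = quadForm A f + (1 / 2) * quadForm A (partialOp m f)
      + (ω ^ 2 / 2) * quadForm A (coordOp m f) := by
  have h1 : partialOp m (A f) = A (partialOp m f) := LinearMap.congr_fun hA.1 f
  have h2 : coordOp m (A f) = A (coordOp m f) := LinearMap.congr_fun hA.2 f
  rw [quadForm, Module.End.mul_apply, realInner_oneBodyOp_expand, h1, h2]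
  rfl

/-- The product of the one-particle operators `S_j²`, `j ∈ T`. -/
def prodOp (ω : ℝ) (T : Finset (Fin N)) : SchwartzOp N :=
  T.noncommProd (oneBodyOp ω) fun i _ j _ _ => commute_oneBodyOp_oneBodyOp ω i j

lemma prodOp_empty (ω : ℝ) : prodOp ω (∅ : Finset (Fin N)) = 1 :=
  Finset.noncommProd_empty _ _

lemma prodOp_insert (ω : ℝ) {T : Finset (Fin N)} {m : Fin N} (hm : m ∉ T) :
    prodOp ω (insert m T) = oneBodyOp ω m * prodOp ω T :=
  Finset.noncommProd_insert_of_notMem _ _ _ _ hm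

lemma prodOp_insert' (ω : ℝ) {T : Finset (Fin N)} {m : Fin N} (hm : m ∉ T) :
    prodOp ω (insert m T) = prodOp ω T * oneBodyOp ω m :=
  Finset.noncommProd_insert_of_notMem' _ _ _ _ hm

lemma CommutesAt.prodOp (ω : ℝ) {T : Finset (Fin N)} {m : Fin N} (hm : m ∉ T) :
    CommutesAt m (prodOp ω T) := by
  induction T using Finset.induction_on with
  | empty => rw [prodOp_empty]; exact CommutesAt.one
  | insert a T ha ih =>
    rw [Finset.mem_insert, not_or] at hm
    rw [prodOp_insert ω ha]
    exact (CommutesAt.oneBodyOp ω hm.1).mul (ih hm.2)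

lemma commute_oneBodyOp_prodOp (ω : ℝ) (m : Fin N) (T : Finset (Fin N)) :
    Commute (oneBodyOp ω m) (prodOp ω T) :=
  Finset.noncommProd_commute _ _ _ _ fun j _ => commute_oneBodyOp_oneBodyOp ω m j

lemma realInner_prodOp_left (ω : ℝ) (T : Finset (Fin N)) (f g : 𝓢(Fin N → ℝ, ℂ)) :
    realInner (prodOp ω T f) g = realInner f (prodOp ω T g) := by
  induction T using Finset.induction_on generalizing f g with
  | empty => simp [prodOp_empty]
  | insert a T ha ih =>
    rw [prodOp_insert ω ha, Module.End.mul_apply, realInner_oneBodyOp_left, ih,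
      ← Module.End.mul_apply, ← (commute_oneBodyOp_prodOp ω a T).eq]

/-- Operator inequalities not involving the variables in `T` may be multiplied by
`∏_{j ∈ T} S_j²`. -/
lemma quadForm_prodOp_mul_mono (ω : ℝ) {T : Finset (Fin N)} {A B : SchwartzOp N}
    (hA : ∀ m ∈ T, CommutesAt m A) (hB : ∀ m ∈ T, CommutesAt m B)
    (h : ∀ f, quadForm A f ≤ quadForm B f) (f : 𝓢(Fin N → ℝ, ℂ)) :
    quadForm (prodOp ω T * A) f ≤ quadForm (prodOp ω T * B) f := by
  induction T using Finset.induction_on generalizing f with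
  | empty => simpa [prodOp_empty] using h f
  | insert a T ha ih =>
    have ih' := ih (fun m hm => hA m (Finset.mem_insert_of_mem hm))
      (fun m hm => hB m (Finset.mem_insert_of_mem hm))
    have hA' := (CommutesAt.prodOp ω ha).mul (hA a (Finset.mem_insert_self a T))
    have hB' := (CommutesAt.prodOp ω ha).mul (hB a (Finset.mem_insert_self a T))
    rw [prodOp_insert ω ha, mul_assoc, mul_assoc, quadForm_oneBodyOp_mul ω hA',
      quadForm_oneBodyOp_mul ω hB']
    gcongr <;> exact ih' _

lemma abs_quadForm_prodOp_mul_le (ω : ℝ) {T : Finset (Fin N)} {A B : SchwartzOp N}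
    (hA : ∀ m ∈ T, CommutesAt m A) (hB : ∀ m ∈ T, CommutesAt m B)
    (h : ∀ f, |quadForm A f| ≤ quadForm B f) (f : 𝓢(Fin N → ℝ, ℂ)) :
    |quadForm (prodOp ω T * A) f| ≤ quadForm (prodOp ω T * B) f := by
  rw [abs_le']
  refine ⟨quadForm_prodOp_mul_mono ω hA hB (fun f => (abs_le'.1 (h f)).1) f, ?_⟩
  rw [← quadForm_neg, ← mul_neg]
  exact quadForm_prodOp_mul_mono ω (fun m hm => (hA m hm).neg) hB
    (fun f => by rw [quadForm_neg]; exact (abs_le'.1 (h f)).2) f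

lemma quadForm_one_le_oneBodyOp (ω : ℝ) (j : Fin N) (f : 𝓢(Fin N → ℝ, ℂ)) :
    quadForm 1 f ≤ quadForm (oneBodyOp ω j) f := by
  rw [quadForm_oneBodyOp, quadForm_one]
  have h1 := realInner_self_nonneg (partialOp j f)
  have h2 := mul_nonneg (sq_nonneg ω) (realInner_self_nonneg (coordOp j f))
  linarith

lemma quadForm_prodOp_nonneg (ω : ℝ) (T : Finset (Fin N)) (f : 𝓢(Fin N → ℝ, ℂ)) :
    0 ≤ quadForm (prodOp ω T) f := by
  have := quadForm_prodOp_mul_mono ω (T := T) (fun m _ => CommutesAt.zero)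
    (fun m _ => CommutesAt.one) (fun f => by
      rw [quadForm_zero, quadForm_one]; exact realInner_self_nonneg f) f
  rwa [mul_zero, mul_one, quadForm_zero] at this

lemma quadForm_prodOp_le_mul_oneBodyOp (ω : ℝ) {T : Finset (Fin N)} {m : Fin N} (hm : m ∉ T)
    (f : 𝓢(Fin N → ℝ, ℂ)) :
    quadForm (prodOp ω T) f ≤ quadForm (prodOp ω T * oneBodyOp ω m) f := by
  have := quadForm_prodOp_mul_mono ω (T := T) (fun m _ => CommutesAt.one)
    (fun a ha => CommutesAt.oneBodyOp ω (j := m) (fun h : a = m => hm (h ▸ ha)))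
    (fun f => quadForm_one_le_oneBodyOp ω m f) f
  rwa [mul_one] at this

lemma prodOp_erase_mul (ω : ℝ) {T : Finset (Fin N)} {m : Fin N} (hm : m ∈ T) :
    prodOp ω (T.erase m) * oneBodyOp ω m = prodOp ω T := by
  rw [← prodOp_insert' ω (Finset.notMem_erase m T), Finset.insert_erase hm]

lemma quadForm_prodOp_mul_oneBodyOp_nonneg (ω : ℝ) (T : Finset (Fin N)) (m : Fin N)
    (f : 𝓢(Fin N → ℝ, ℂ)) : 0 ≤ quadForm (prodOp ω T * oneBodyOp ω m) f := by
  by_cases hm : m ∈ T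
  · have hc : ∀ a ∈ T.erase m, CommutesAt a (oneBodyOp ω m * oneBodyOp ω m) := fun a ha =>
      have := CommutesAt.oneBodyOp ω (Finset.ne_of_mem_erase ha)
      this.mul this
    have := quadForm_prodOp_mul_mono ω (T := T.erase m) (fun m _ => CommutesAt.zero) hc
      (fun f => by
        rw [quadForm_zero, quadForm, Module.End.mul_apply, ← realInner_oneBodyOp_left]
        exact realInner_self_nonneg _) f
    rwa [mul_zero, quadForm_zero, ← mul_assoc, prodOp_erase_mul ω hm] at this
  · exact (quadForm_prodOp_nonneg ω T f).trans (quadForm_prodOp_le_mul_oneBodyOp ω hm f)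

end oneBody

section pairBounds

variable {N : ℕ}

lemma abs_quadForm_pairOp_le (ω : ℝ) (W : 𝓢(ℝ, ℝ)) {i j : Fin N} (hij : i ≠ j)
    (f : 𝓢(Fin N → ℝ, ℂ)) :
    |quadForm (pairOp W i j) f| ≤
      quadForm ((∫ s, |W s|) ^ 2 • 1 + (1 / 2 : ℝ) • oneBodyOp ω j) f := by
  have hI : 0 ≤ ∫ s, |W s| := integral_nonneg fun s => abs_nonneg _
  have h1 := abs_realInner_pairOp_le W i j f f
  have ha := realInner_self_nonneg f
  have hb := realInner_self_nonneg (partialOp j f)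
  have hc := mul_nonneg (sq_nonneg ω) (realInner_self_nonneg (coordOp j f))
  rw [quadForm_add, quadForm_smul, quadForm_smul, quadForm_one, quadForm_oneBodyOp]
  have h2 : ∫ x, |W (x i - x j)| * ‖f x‖ ^ 2 ≤ (∫ s, |W s|) ^ 2 * realInner f f
      + (1 / 4) * realInner (partialOp j f) (partialOp j f) := by
    rcases hI.eq_or_lt with h0 | hpos
    · refine (integral_abs_weight_mul_norm_sq_le W hij f one_pos).trans ?_
      rw [← h0]
      linarith
    · refine (integral_abs_weight_mul_norm_sq_le W hij f hpos).trans_eq ?_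
      field_simp
  refine h1.trans ?_
  linarith

lemma integral_abs_weight_le_quadForm (ω : ℝ) (W : 𝓢(ℝ, ℝ)) {i j : Fin N} (hij : i ≠ j)
    (f : 𝓢(Fin N → ℝ, ℂ)) :
    ∫ x, |W (x i - x j)| * ‖f x‖ ^ 2 ≤ (∫ s, |W s|) * quadForm (oneBodyOp ω j) f := by
  have hI : 0 ≤ ∫ s, |W s| := integral_nonneg fun s => abs_nonneg _
  refine (integral_abs_weight_mul_norm_sq_le W hij f one_pos).trans ?_
  have hb := realInner_self_nonneg (partialOp j f)
  have hc := mul_nonneg (sq_nonneg ω) (realInner_self_nonneg (coordOp j f))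
  rw [quadForm_oneBodyOp]
  refine mul_le_mul_of_nonneg_left ?_ hI
  linarith

lemma abs_quadForm_oneBodyOp_mul_pairOp_le (ω : ℝ) (W : 𝓢(ℝ, ℝ)) {i j : Fin N} (hij : i ≠ j)
    (f : 𝓢(Fin N → ℝ, ℂ)) :
    |quadForm (oneBodyOp ω i * pairOp W i j) f| ≤
      quadForm (((∫ s, |W s|) + ∫ s, |schwartzDeriv W s|) •
        (oneBodyOp ω i * oneBodyOp ω j)) f := by
  have hP : partialOp i (pairOp W i j f)
      = pairOp W i j (partialOp i f) + pairOp (schwartzDeriv W) i j f :=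
    LinearMap.congr_fun (partialOp_mul_pairOp_left W hij) f
  have hX : coordOp i (pairOp W i j f) = pairOp W i j (coordOp i f) :=
    LinearMap.congr_fun (commute_coordOp_pairOp W i j i) f
  rw [quadForm_smul, quadForm_oneBodyOp_mul ω (CommutesAt.oneBodyOp ω hij), quadForm,
    Module.End.mul_apply, realInner_oneBodyOp_expand, hP, hX, realInner_add_right]
  have hI : 0 ≤ ∫ s, |W s| := integral_nonneg fun s => abs_nonneg _
  have hI' : 0 ≤ ∫ s, |schwartzDeriv W s| := integral_nonneg fun s => abs_nonneg _
  have hpos (g : 𝓢(Fin N → ℝ, ℂ)) : 0 ≤ quadForm (oneBodyOp ω j) g :=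
    (realInner_self_nonneg g).trans (quadForm_one_le_oneBodyOp ω j g)
  have hself (g : 𝓢(Fin N → ℝ, ℂ)) :
      |realInner g (pairOp W i j g)| ≤ (∫ s, |W s|) * quadForm (oneBodyOp ω j) g := by
    refine (abs_realInner_pairOp_le W i j g g).trans ?_
    linarith [integral_abs_weight_le_quadForm ω W hij g]
  have hcross := abs_realInner_pairOp_le (schwartzDeriv W) i j (partialOp i f) f
  have h1 := integral_abs_weight_le_quadForm ω (schwartzDeriv W) hij (partialOp i f)
  have h2 := integral_abs_weight_le_quadForm ω (schwartzDeriv W) hij f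
  have e1 := hself f
  have e2 := hself (partialOp i f)
  have e3 := hself (coordOp i f)
  have p1 := mul_nonneg hI' (hpos f)
  have p2 := mul_nonneg hI' (hpos (partialOp i f))
  have p3 := mul_nonneg hI' (hpos (coordOp i f))
  have hω : 0 ≤ ω ^ 2 / 2 := by positivity
  have p4 := mul_nonneg hω p3
  rw [abs_le] at *
  have e3l := mul_le_mul_of_nonneg_left e3.1 hω
  have e3r := mul_le_mul_of_nonneg_left e3.2 hω
  constructor <;> linarith

lemma abs_quadForm_oneBodyOp_mul_oneBodyOp_mul_pairOp_le (ω : ℝ) {W : 𝓢(ℝ, ℝ)} {C : ℝ}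
    (hC : ∀ s, |W s| ≤ C) {d : ℝ} (hd : 0 < d) {i j : Fin N} (hij : i ≠ j)
    (f : 𝓢(Fin N → ℝ, ℂ)) :
    |quadForm (oneBodyOp ω i * (oneBodyOp ω j * pairOp W i j)) f| ≤
      quadForm ((C + d) • (oneBodyOp ω j * (oneBodyOp ω i * oneBodyOp ω i))
        + (C + d⁻¹ * ∫ s, schwartzDeriv W s ^ 2) • oneBodyOp ω j) f := by
  have hC0 : 0 ≤ C := (abs_nonneg _).trans (hC 0)
  have hK : 0 ≤ d⁻¹ * ∫ s, schwartzDeriv W s ^ 2 :=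
    mul_nonneg (by positivity) (integral_nonneg fun s => sq_nonneg _)
  have hP : partialOp j (pairOp W i j f)
      = pairOp W i j (partialOp j f) - pairOp (schwartzDeriv W) i j f :=
    LinearMap.congr_fun (partialOp_mul_pairOp_right W hij) f
  have hX : coordOp j (pairOp W i j f) = pairOp W i j (coordOp j f) :=
    LinearMap.congr_fun (commute_coordOp_pairOp W i j j) f
  have hS := CommutesAt.oneBodyOp ω hij.symm
  have hSP : partialOp j (oneBodyOp ω i f) = oneBodyOp ω i (partialOp j f) :=
    LinearMap.congr_fun hS.1 f
  have hSX : coordOp j (oneBodyOp ω i f) = oneBodyOp ω i (coordOp j f) :=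
    LinearMap.congr_fun hS.2 f
  have hsq (g : 𝓢(Fin N → ℝ, ℂ)) : quadForm (oneBodyOp ω i * oneBodyOp ω i) g
      = realInner (oneBodyOp ω i g) (oneBodyOp ω i g) := by
    rw [quadForm, Module.End.mul_apply, realInner_oneBodyOp_left]
  rw [quadForm_add, quadForm_smul, quadForm_smul, quadForm_oneBodyOp_mul ω (hS.mul hS),
    quadForm_oneBodyOp, quadForm, Module.End.mul_apply, Module.End.mul_apply,
    ← realInner_oneBodyOp_left, realInner_oneBodyOp_expand, hP, hX, hSP, hSX,
    realInner_sub_right, hsq, hsq, hsq]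
  have e1 := abs_realInner_pairOp_le_of_bound hC i j (oneBodyOp ω i f) f
  have e2 := abs_realInner_pairOp_le_of_bound hC i j (oneBodyOp ω i (partialOp j f)) (partialOp j f)
  have e3 := abs_realInner_pairOp_le_of_bound hC i j (oneBodyOp ω i (coordOp j f)) (coordOp j f)
  have e4 := abs_realInner_le_add (oneBodyOp ω i (partialOp j f))
    (pairOp (schwartzDeriv W) i j f) hd
  have e5 := mul_le_mul_of_nonneg_left
    (realInner_pairOp_self_le (schwartzDeriv W) hij f one_pos) (inv_nonneg.2 hd.le)
  rw [← mul_assoc] at e5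
  have a1 := realInner_self_nonneg f
  have a2 := realInner_self_nonneg (partialOp j f)
  have a3 := realInner_self_nonneg (coordOp j f)
  have b1 := realInner_self_nonneg (oneBodyOp ω i f)
  have b2 := realInner_self_nonneg (oneBodyOp ω i (partialOp j f))
  have b3 := realInner_self_nonneg (oneBodyOp ω i (coordOp j f))
  have hω : 0 ≤ ω ^ 2 / 2 := by positivity
  have c1 := mul_nonneg hC0 a1
  have c2 := mul_nonneg hC0 a2
  have c3 := mul_nonneg hω (mul_nonneg hC0 a3)
  have c4 := mul_nonneg hC0 b1
  have c5 := mul_nonneg hC0 b2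
  have c6 := mul_nonneg hω (mul_nonneg hC0 b3)
  have d1 := mul_nonneg hd.le b1
  have d2 := mul_nonneg hd.le b2
  have d3 := mul_nonneg hω (mul_nonneg hd.le b3)
  have k1 := mul_nonneg hK a1
  have k2 := mul_nonneg hK a2
  have k3 := mul_nonneg hω (mul_nonneg hK a3)
  rw [abs_le] at *
  have e3l := mul_le_mul_of_nonneg_left e3.1 hω
  have e3r := mul_le_mul_of_nonneg_left e3.2 hω
  constructor <;> linarith

/-- Both variables of the pair lie outside of `T`. -/
lemma abs_quadForm_prodOp_mul_pairOp_le_of_notMem (ω : ℝ) (W : 𝓢(ℝ, ℝ)) {T : Finset (Fin N)}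
    {i j : Fin N} (hi : i ∉ T) (hj : j ∉ T) (hij : i ≠ j) (f : 𝓢(Fin N → ℝ, ℂ)) :
    |quadForm (prodOp ω T * pairOp W i j) f| ≤ (∫ s, |W s|) ^ 2 * quadForm (prodOp ω T) f
      + (1 / 2) * quadForm (prodOp ω T * oneBodyOp ω j) f := by
  have hne {m : Fin N} (hm : m ∈ T) : m ≠ i ∧ m ≠ j :=
    ⟨fun h => hi (h ▸ hm), fun h => hj (h ▸ hm)⟩
  have := abs_quadForm_prodOp_mul_le ω (T := T)
    (fun m hm => CommutesAt.pairOp W (hne hm).1 (hne hm).2)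
    (fun m hm => (CommutesAt.one.smul _).add ((CommutesAt.oneBodyOp ω (hne hm).2).smul _))
    (fun f => abs_quadForm_pairOp_le ω W hij f) f
  rwa [mul_add, mul_smul_comm, mul_smul_comm, mul_one, quadForm_add, quadForm_smul,
    quadForm_smul] at this

/-- Exactly one variable of the pair lies in `T`. -/
lemma abs_quadForm_prodOp_mul_pairOp_le_of_mem_of_notMem (ω : ℝ) (W : 𝓢(ℝ, ℝ))
    {T : Finset (Fin N)} {i j : Fin N} (hi : i ∈ T) (hj : j ∉ T) (f : 𝓢(Fin N → ℝ, ℂ)) :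
    |quadForm (prodOp ω T * pairOp W i j) f| ≤
      ((∫ s, |W s|) + ∫ s, |schwartzDeriv W s|) * quadForm (prodOp ω T * oneBodyOp ω j) f := by
  have hij : i ≠ j := fun h => hj (h ▸ hi)
  have hne {m : Fin N} (hm : m ∈ T.erase i) : m ≠ i ∧ m ≠ j :=
    ⟨Finset.ne_of_mem_erase hm, fun h => hj (h ▸ Finset.mem_of_mem_erase hm)⟩
  have := abs_quadForm_prodOp_mul_le ω (T := T.erase i)
    (fun m hm => (CommutesAt.oneBodyOp ω (hne hm).1).mul
      (CommutesAt.pairOp W (hne hm).1 (hne hm).2))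
    (fun m hm => ((CommutesAt.oneBodyOp ω (hne hm).1).mul
      (CommutesAt.oneBodyOp ω (hne hm).2)).smul _)
    (fun f => abs_quadForm_oneBodyOp_mul_pairOp_le ω W hij f) f
  rwa [mul_smul_comm, quadForm_smul, ← mul_assoc, ← mul_assoc, prodOp_erase_mul ω hi] at this

/-- Both variables of the pair lie in `T`. -/
lemma abs_quadForm_prodOp_mul_pairOp_le_of_mem (ω : ℝ) {W : 𝓢(ℝ, ℝ)} {C : ℝ}
    (hC : ∀ s, |W s| ≤ C) {d : ℝ} (hd : 0 < d) {T : Finset (Fin N)} {i j : Fin N}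
    (hi : i ∈ T) (hj : j ∈ T) (hij : i ≠ j) (f : 𝓢(Fin N → ℝ, ℂ)) :
    |quadForm (prodOp ω T * pairOp W i j) f| ≤
      (C + d) * quadForm (prodOp ω T * oneBodyOp ω i) f
      + (C + d⁻¹ * ∫ s, schwartzDeriv W s ^ 2) * quadForm (prodOp ω T) f := by
  have hC0 : 0 ≤ C := (abs_nonneg _).trans (hC 0)
  have hK : 0 ≤ d⁻¹ * ∫ s, schwartzDeriv W s ^ 2 :=
    mul_nonneg (by positivity) (integral_nonneg fun s => sq_nonneg _)
  have hji : j ∈ T.erase i := Finset.mem_erase.2 ⟨hij.symm, hj⟩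
  have hne {m : Fin N} (hm : m ∈ (T.erase i).erase j) : m ≠ i ∧ m ≠ j :=
    ⟨Finset.ne_of_mem_erase (Finset.mem_of_mem_erase hm), Finset.ne_of_mem_erase hm⟩
  have hSi {m : Fin N} (hm : m ∈ (T.erase i).erase j) := CommutesAt.oneBodyOp ω (hne hm).1
  have hSj {m : Fin N} (hm : m ∈ (T.erase i).erase j) := CommutesAt.oneBodyOp ω (hne hm).2
  have key := abs_quadForm_prodOp_mul_le ω (T := (T.erase i).erase j)
    (fun m hm => (hSi hm).mul ((hSj hm).mul (CommutesAt.pairOp W (hne hm).1 (hne hm).2)))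
    (fun m hm => (((hSj hm).mul ((hSi hm).mul (hSi hm))).smul _).add ((hSj hm).smul _))
    (fun f => abs_quadForm_oneBodyOp_mul_oneBodyOp_mul_pairOp_le ω hC hd hij f) f
  have h1 : prodOp ω ((T.erase i).erase j) * (oneBodyOp ω i * (oneBodyOp ω j * pairOp W i j))
      = prodOp ω T * pairOp W i j := by
    rw [← mul_assoc (oneBodyOp ω i), (commute_oneBodyOp_oneBodyOp ω i j).eq, mul_assoc,
      ← mul_assoc, prodOp_erase_mul ω hji, ← mul_assoc, prodOp_erase_mul ω hi]
  have h2 : prodOp ω ((T.erase i).erase j) * (oneBodyOp ω j * (oneBodyOp ω i * oneBodyOp ω i))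
      = prodOp ω T * oneBodyOp ω i := by
    rw [← mul_assoc, prodOp_erase_mul ω hji, ← mul_assoc, prodOp_erase_mul ω hi]
  rw [mul_add, mul_smul_comm, mul_smul_comm, quadForm_add, quadForm_smul, quadForm_smul, h1, h2,
    prodOp_erase_mul ω hji] at key
  have hmono : quadForm (prodOp ω (T.erase i)) f ≤ quadForm (prodOp ω T) f := by
    have := quadForm_prodOp_le_mul_oneBodyOp ω (Finset.notMem_erase i T) f
    rwa [prodOp_erase_mul ω hi] at this
  refine key.trans ?_
  gcongr

end pairBounds

section scaling

/-- The rescaled potential `x ↦ c W (c x)`. -/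
def scaleSchwartz (c : ℝˣ) (W : 𝓢(ℝ, ℝ)) : 𝓢(ℝ, ℝ) :=
  (c : ℝ) • SchwartzMap.compCLMOfContinuousLinearEquiv ℝ
    (ContinuousLinearEquiv.unitsEquivAut ℝ c) W

lemma scaleSchwartz_apply (c : ℝˣ) (W : 𝓢(ℝ, ℝ)) (x : ℝ) :
    scaleSchwartz c W x = c * W (c * x) := by
  simp [scaleSchwartz, mul_comm]

lemma schwartzDeriv_scaleSchwartz_apply (c : ℝˣ) (W : 𝓢(ℝ, ℝ)) (x : ℝ) :
    schwartzDeriv (scaleSchwartz c W) x = (c : ℝ) ^ 2 * schwartzDeriv W (c * x) := by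
  have h : (scaleSchwartz c W : ℝ → ℝ) = fun y => (c : ℝ) * W (c * y) :=
    funext (scaleSchwartz_apply c W)
  simp only [schwartzDeriv, SchwartzMap.derivCLM_apply]
  rw [h, deriv_const_mul_field, deriv_comp_mul_left, smul_eq_mul]
  ring

lemma integral_abs_scaleSchwartz {c : ℝˣ} (hc : 0 < (c : ℝ)) (W : 𝓢(ℝ, ℝ)) :
    ∫ s, |scaleSchwartz c W s| = ∫ s, |W s| := by
  simp only [scaleSchwartz_apply, abs_mul, abs_of_pos hc]
  rw [integral_const_mul, Measure.integral_comp_mul_left (fun s => |W s|), smul_eq_mul,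
    abs_of_pos (inv_pos.2 hc), mul_inv_cancel_left₀ hc.ne']

lemma integral_abs_schwartzDeriv_scaleSchwartz {c : ℝˣ} (hc : 0 < (c : ℝ)) (W : 𝓢(ℝ, ℝ)) :
    ∫ s, |schwartzDeriv (scaleSchwartz c W) s| = c * ∫ s, |schwartzDeriv W s| := by
  simp only [schwartzDeriv_scaleSchwartz_apply, abs_mul, abs_of_pos (pow_pos hc 2)]
  rw [integral_const_mul, Measure.integral_comp_mul_left (fun s => |schwartzDeriv W s|),
    smul_eq_mul, abs_of_pos (inv_pos.2 hc)]
  field_simp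

lemma integral_schwartzDeriv_scaleSchwartz_sq {c : ℝˣ} (hc : 0 < (c : ℝ)) (W : 𝓢(ℝ, ℝ)) :
    ∫ s, schwartzDeriv (scaleSchwartz c W) s ^ 2 = (c : ℝ) ^ 3 * ∫ s, schwartzDeriv W s ^ 2 := by
  simp only [schwartzDeriv_scaleSchwartz_apply, mul_pow]
  rw [integral_const_mul, Measure.integral_comp_mul_left (fun s => schwartzDeriv W s ^ 2),
    smul_eq_mul, abs_of_pos (inv_pos.2 hc)]
  field_simp

lemma abs_scaleSchwartz_le {c : ℝˣ} (hc : 0 < (c : ℝ)) {W : 𝓢(ℝ, ℝ)} {C : ℝ}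
    (hC : ∀ s, |W s| ≤ C) (s : ℝ) : |scaleSchwartz c W s| ≤ c * C := by
  rw [scaleSchwartz_apply, abs_mul, abs_of_pos hc]
  exact mul_le_mul_of_nonneg_left (hC _) hc.le

lemma scaleSchwartz_neg {W : 𝓢(ℝ, ℝ)} (hW : ∀ x, W (-x) = W x) (c : ℝˣ) (x : ℝ) :
    scaleSchwartz c W (-x) = scaleSchwartz c W x := by
  rw [scaleSchwartz_apply, scaleSchwartz_apply, mul_neg, hW]

lemma pairOp_comm_of_even {N : ℕ} {W : 𝓢(ℝ, ℝ)} (hW : ∀ x, W (-x) = W x) (i j : Fin N) :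
    pairOp W i j = pairOp W j i := by
  refine LinearMap.ext fun f => SchwartzMap.ext fun x => ?_
  rw [pairOp_apply, pairOp_apply, ← hW, neg_sub]

end scaling

section permutations

variable {N : ℕ}

/-- Permutation of the variables: `f ↦ (x ↦ f (x ∘ σ))`. -/
def permOp (σ : Equiv.Perm (Fin N)) : SchwartzOp N :=
  (SchwartzMap.compCLMOfContinuousLinearEquiv ℝ
    (LinearEquiv.funCongrLeft ℝ ℝ σ).toContinuousLinearEquiv).toLinearMap

lemma permOp_apply (σ : Equiv.Perm (Fin N)) (f : 𝓢(Fin N → ℝ, ℂ)) (x : Fin N → ℝ) :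
    permOp σ f x = f (x ∘ σ) := rfl

lemma isSymmetricFn_iff_permOp {f : 𝓢(Fin N → ℝ, ℂ)} :
    IsSymmetricFn ⇑f ↔ ∀ σ, permOp σ f = f :=
  ⟨fun h σ => SchwartzMap.ext fun x => h σ x, fun h σ x => DFunLike.congr_fun (h σ) x⟩

lemma realInner_permOp (σ : Equiv.Perm (Fin N)) (f g : 𝓢(Fin N → ℝ, ℂ)) :
    realInner (permOp σ f) (permOp σ g) = realInner f g := by
  have h := volume_measurePreserving_piCongrLeft (fun _ : Fin N => ℝ) σ.symm
  have he : ∀ x : Fin N → ℝ,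
      MeasurableEquiv.piCongrLeft (fun _ : Fin N => ℝ) σ.symm x = x ∘ σ := fun x => by
    funext i
    have := MeasurableEquiv.piCongrLeft_apply_apply (β := fun _ : Fin N => ℝ) σ.symm x (σ i)
    simpa using this
  have := h.integral_comp (MeasurableEquiv.measurableEmbedding _)
    (fun x => inner ℝ (f x) (g x))
  simp only [he] at this
  exact this

lemma partialOp_mul_permOp (σ : Equiv.Perm (Fin N)) (m : Fin N) :
    partialOp (σ m) * permOp σ = permOp σ * partialOp m := by
  refine LinearMap.ext fun f => ?_
  refine (SchwartzMap.lineDerivOp_compCLMOfContinuousLinearEquiv ℝ _ _ f).trans ?_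
  have : (LinearEquiv.funCongrLeft ℝ ℝ σ).toContinuousLinearEquiv (Pi.single (σ m) (1 : ℝ))
      = Pi.single m 1 := by
    funext i
    simp [LinearEquiv.funCongrLeft_apply, LinearMap.funLeft_apply, Pi.single_apply]
  rw [this]
  rfl

lemma coordOp_mul_permOp (σ : Equiv.Perm (Fin N)) (m : Fin N) :
    coordOp (σ m) * permOp σ = permOp σ * coordOp m := by
  refine LinearMap.ext fun f => SchwartzMap.ext fun x => ?_
  simp only [Module.End.mul_apply, permOp_apply, coordOp_apply, Function.comp_apply]

lemma pairOp_mul_permOp (W : 𝓢(ℝ, ℝ)) (σ : Equiv.Perm (Fin N)) (i j : Fin N) :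
    pairOp W (σ i) (σ j) * permOp σ = permOp σ * pairOp W i j := by
  refine LinearMap.ext fun f => SchwartzMap.ext fun x => ?_
  simp only [Module.End.mul_apply, permOp_apply, pairOp_apply, Function.comp_apply]

lemma oneBodyOp_mul_permOp (ω : ℝ) (σ : Equiv.Perm (Fin N)) (m : Fin N) :
    oneBodyOp ω (σ m) * permOp σ = permOp σ * oneBodyOp ω m := by
  simp only [oneBodyOp, add_mul, sub_mul, mul_add, mul_sub, one_mul, mul_one, smul_mul_assoc,
    mul_smul_comm, mul_assoc, partialOp_mul_permOp, coordOp_mul_permOp]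
  simp only [← mul_assoc, partialOp_mul_permOp, coordOp_mul_permOp]

lemma commute_prodOp_permOp (ω : ℝ) {T : Finset (Fin N)} {σ : Equiv.Perm (Fin N)}
    (h : ∀ m ∈ T, σ m = m) : Commute (prodOp ω T) (permOp σ) := by
  refine (Finset.noncommProd_commute _ _ _ _ fun m hm => ?_).symm
  have := oneBodyOp_mul_permOp ω σ m
  rw [h m hm] at this
  exact this.symm

/-- Exchanging two variables outside of `T`. -/
lemma realInner_prodOp_mul_oneBodyOp_swap (ω : ℝ) {T : Finset (Fin N)} {a b : Fin N}
    (ha : a ∉ T) (hb : b ∉ T) {f g : 𝓢(Fin N → ℝ, ℂ)} (hf : permOp (Equiv.swap a b) f = f)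
    (hg : permOp (Equiv.swap a b) g = g) :
    realInner ((prodOp ω T * oneBodyOp ω a) f) g
      = realInner ((prodOp ω T * oneBodyOp ω b) f) g := by
  have hT : ∀ m ∈ T, Equiv.swap a b m = m := fun m hm =>
    Equiv.swap_apply_of_ne_of_ne (fun h => ha (h ▸ hm)) (fun h => hb (h ▸ hm))
  have h := oneBodyOp_mul_permOp ω (Equiv.swap a b) a
  rw [Equiv.swap_apply_left] at h
  have hperm : (prodOp ω T * oneBodyOp ω b) (permOp (Equiv.swap a b) f)
      = permOp (Equiv.swap a b) ((prodOp ω T * oneBodyOp ω a) f) := by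
    rw [← Module.End.mul_apply, mul_assoc, h, ← mul_assoc, (commute_prodOp_permOp ω hT).eq]
    rfl
  rw [← realInner_permOp (Equiv.swap a b), ← hperm, hf, hg]

end permutations

section hamiltonian

variable {N : ℕ}

lemma deriv_comp_update (f : 𝓢(Fin N → ℝ, ℂ)) (j : Fin N) (x : Fin N → ℝ) (t : ℝ) :
    deriv (fun t => f (Function.update x j t)) t = partialOp j f (Function.update x j t) :=
  ((f.differentiableAt.hasFDerivAt (x := Function.update x j t)).comp_hasDerivAt t
    (hasDerivAt_update x j t)).deriv

lemma d2_coe (f : 𝓢(Fin N → ℝ, ℂ)) (j : Fin N) : d2 j f = partialOp j (partialOp j f) := by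
  funext x
  have h (g : 𝓢(Fin N → ℝ, ℂ)) : deriv (fun t => g (Function.update x j t))
      = fun t => partialOp j g (Function.update x j t) := funext (deriv_comp_update g j x)
  rw [d2, iteratedDeriv_succ, iteratedDeriv_one, h, h]
  exact congrArg _ (Function.update_eq_self j x)

lemma oneBodyOp_apply (ω : ℝ) (j : Fin N) (f : 𝓢(Fin N → ℝ, ℂ)) (x : Fin N → ℝ) :
    oneBodyOp ω j f x = f x + (-(1 / 2 : ℂ) * d2 j f x
      + (1 / 2 : ℂ) * (ω : ℂ) ^ 2 * ((x j : ℝ) : ℂ) ^ 2 * f x) := by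
  simp only [d2_coe, oneBodyOp, LinearMap.add_apply, LinearMap.sub_apply, LinearMap.smul_apply,
    Module.End.mul_apply, Module.End.one_apply, add_apply, sub_apply,
    smul_apply, coordOp_apply, Complex.real_smul]
  push_cast
  ring

lemma Ssq_coe (ω : ℝ) (j : Fin N) (f : 𝓢(Fin N → ℝ, ℂ)) : Ssq ω j f = oneBodyOp ω j f := by
  funext x
  rw [oneBodyOp_apply, Ssq]
  ring

/-- The indices of the first `k` variables. -/
def firstVars (N k : ℕ) : Finset (Fin N) := Finset.univ.filter fun j => (j : ℕ) < k

lemma mem_firstVars {k : ℕ} {j : Fin N} : j ∈ firstVars N k ↔ (j : ℕ) < k := by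
  simp [firstVars]

lemma firstVars_zero : firstVars N 0 = ∅ := by simp [firstVars]

lemma firstVars_succ {k : ℕ} (h : k < N) : firstVars N (k + 1) = insert ⟨k, h⟩ (firstVars N k) := by
  ext j
  simp only [mem_firstVars, Finset.mem_insert, Fin.ext_iff]
  omega

lemma notMem_firstVars {k : ℕ} (h : k < N) : (⟨k, h⟩ : Fin N) ∉ firstVars N k := by
  simp [mem_firstVars]

lemma card_firstVars {k : ℕ} (h : k ≤ N) : (firstVars N k).card = k := by
  induction k with
  | zero => simp [firstVars_zero]
  | succ k ih =>
    rw [firstVars_succ h, Finset.card_insert_of_notMem (notMem_firstVars h), ih (by omega)]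

lemma Sprod_coe (ω : ℝ) {k : ℕ} (hk : k ≤ N) (f : 𝓢(Fin N → ℝ, ℂ)) :
    Sprod ω N k f = prodOp ω (firstVars N k) f := by
  induction k with
  | zero => simp [firstVars_zero, prodOp_empty, Sprod]
  | succ k ih =>
    have hkN : k < N := hk
    rw [Sprod, dif_pos hkN, ih hkN.le, Ssq_coe, firstVars_succ hkN,
      prodOp_insert ω (notMem_firstVars hkN), Module.End.mul_apply]

/-- The operator `∑_m S_m² + N a + (2N)⁻¹ ∑_{i ≠ j} W (x_i - x_j)`. -/
def hamOp (N : ℕ) (ω a : ℝ) (W : 𝓢(ℝ, ℝ)) : SchwartzOp N :=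
  ∑ m, oneBodyOp ω m + (N * a) • 1
    + (2 * N : ℝ)⁻¹ • ∑ p ∈ Finset.univ.offDiag, pairOp W p.1 p.2

lemma sum_lt_eq_half_sum_offDiag {F : Fin N → Fin N → ℂ} (hF : ∀ i j, F i j = F j i) :
    ∑ p : Fin N × Fin N, (if p.1 < p.2 then F p.1 p.2 else 0)
      = (1 / 2) * ∑ p ∈ Finset.univ.offDiag, F p.1 p.2 := by
  have hswap : ∑ p : Fin N × Fin N, (if p.1 < p.2 then F p.1 p.2 else 0)
      = ∑ p : Fin N × Fin N, (if p.2 < p.1 then F p.1 p.2 else 0) := by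
    rw [← (Equiv.prodComm (Fin N) (Fin N)).sum_comp]
    refine Finset.sum_congr rfl fun p _ => ?_
    simp only [Equiv.prodComm_apply, Prod.fst_swap, Prod.snd_swap, hF p.2 p.1]
  have hoff : ∑ p ∈ (Finset.univ : Finset (Fin N)).offDiag, F p.1 p.2
      = ∑ p : Fin N × Fin N, ((if p.1 < p.2 then F p.1 p.2 else 0)
        + (if p.2 < p.1 then F p.1 p.2 else 0)) := by
    have hf : (Finset.univ : Finset (Fin N)).offDiag
        = Finset.univ.filter fun p : Fin N × Fin N => p.1 ≠ p.2 := by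
      ext p; simp
    rw [hf, Finset.sum_filter]
    refine Finset.sum_congr rfl fun p _ => ?_
    rcases lt_trichotomy p.1 p.2 with h | h | h
    · simp [h, h.ne, h.not_gt]
    · simp [h]
    · simp [h, h.ne', h.not_gt]
  rw [hoff, Finset.sum_add_distrib, ← hswap]
  ring

lemma HamPlus_coe (ω β a : ℝ) {V : 𝓢(ℝ, ℝ)} (hV : ∀ x, V (-x) = V x) {c : ℝˣ}
    (hc : (c : ℝ) = (N : ℝ) ^ β) (f : 𝓢(Fin N → ℝ, ℂ)) :
    HamPlus ω β V N (N * a + N) f = hamOp N ω a (scaleSchwartz c V) f := by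
  funext x
  rw [HamPlus, HamN, ← hc]
  simp only [← scaleSchwartz_apply]
  rw [sum_lt_eq_half_sum_offDiag (F := fun i j => (scaleSchwartz c V (x i - x j) : ℂ) * f x)
    (fun i j => by rw [← neg_sub, scaleSchwartz_neg hV])]
  simp only [hamOp, LinearMap.add_apply, LinearMap.smul_apply, LinearMap.sum_apply,
    Module.End.one_apply, add_apply, smul_apply, sum_apply,
    pairOp_apply, oneBodyOp_apply, Complex.real_smul]
  rw [Finset.sum_add_distrib (f := fun _ => f x), Finset.sum_const, Finset.card_univ,
    Fintype.card_fin, nsmul_eq_mul]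
  push_cast
  rw [mul_inv]
  ring

lemma iterate_HamPlus_coe (ω β a : ℝ) {V : 𝓢(ℝ, ℝ)} (hV : ∀ x, V (-x) = V x) {c : ℝˣ}
    (hc : (c : ℝ) = (N : ℝ) ^ β) (k : ℕ) (f : 𝓢(Fin N → ℝ, ℂ)) :
    (HamPlus ω β V N (N * a + N))^[k] f = (hamOp N ω a (scaleSchwartz c V) ^ k) f := by
  induction k generalizing f with
  | zero => rfl
  | succ k ih =>
    rw [Function.iterate_succ_apply, HamPlus_coe ω β a hV hc, ih, pow_succ, Module.End.mul_apply]

lemma realInner_hamOp_left (ω a : ℝ) (W : 𝓢(ℝ, ℝ)) (f g : 𝓢(Fin N → ℝ, ℂ)) :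
    realInner (hamOp N ω a W f) g = realInner f (hamOp N ω a W g) := by
  simp only [hamOp, LinearMap.add_apply, LinearMap.smul_apply, LinearMap.sum_apply,
    Module.End.one_apply, realInner_add_left, realInner_add_right, realInner_sum_left,
    realInner_sum_right, realInner_smul_left, realInner_smul_right, realInner_oneBodyOp_left,
    realInner_pairOp_left]

lemma commute_hamOp_permOp (ω a : ℝ) (W : 𝓢(ℝ, ℝ)) (σ : Equiv.Perm (Fin N)) :
    Commute (hamOp N ω a W) (permOp σ) := by
  have h1 : Commute (∑ m, oneBodyOp ω m) (permOp σ) := by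
    rw [Commute, SemiconjBy]
    nth_rw 1 [← Equiv.sum_comp σ (oneBodyOp ω)]
    rw [Finset.sum_mul, Finset.mul_sum]
    simp only [oneBodyOp_mul_permOp]
  have h2 : Commute (∑ p ∈ Finset.univ.offDiag, pairOp W p.1 p.2) (permOp σ) := by
    have : ∑ p ∈ (Finset.univ : Finset (Fin N)).offDiag, pairOp W p.1 p.2
        = ∑ p ∈ (Finset.univ : Finset (Fin N)).offDiag, pairOp W (σ p.1) (σ p.2) := by
      refine (Finset.sum_equiv (Equiv.prodCongr σ σ) ?_ ?_).symm
      · simp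
      · simp
    rw [Commute, SemiconjBy]
    nth_rw 1 [this]
    rw [Finset.sum_mul, Finset.mul_sum]
    simp only [pairOp_mul_permOp]
  exact (h1.add_left ((Commute.one_left _).smul_left _)).add_left (h2.smul_left _)

lemma IsSymmetricFn.hamOp {f : 𝓢(Fin N → ℝ, ℂ)} (hf : IsSymmetricFn ⇑f) (ω a : ℝ)
    (W : 𝓢(ℝ, ℝ)) : IsSymmetricFn ⇑(hamOp N ω a W f) := by
  rw [isSymmetricFn_iff_permOp] at hf ⊢
  intro σ
  rw [← Module.End.mul_apply, ← (commute_hamOp_permOp ω a W σ).eq, Module.End.mul_apply, hf]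

end hamiltonian

section energy

variable {N : ℕ}

lemma permOp_sum_compl (ω : ℝ) {T : Finset (Fin N)} {σ : Equiv.Perm (Fin N)}
    (hσ : ∀ m, σ m ∈ T ↔ m ∈ T) {f : 𝓢(Fin N → ℝ, ℂ)} (hf : permOp σ f = f) :
    permOp σ (∑ m ∈ Tᶜ, oneBodyOp ω m f) = ∑ m ∈ Tᶜ, oneBodyOp ω m f := by
  rw [map_sum]
  refine Finset.sum_equiv σ (fun m => by simp [hσ]) fun m _ => ?_
  rw [← Module.End.mul_apply, ← oneBodyOp_mul_permOp, Module.End.mul_apply, hf]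

/-- Completing the square: positivity of `∏_{j ∈ T} S_j²` applied to
`g - ∑_{m ∉ T} S_m² f`. -/
lemma card_compl_mul_le_quadForm_prodOp (ω : ℝ) {T : Finset (Fin N)} {l : Fin N} (hl : l ∉ T)
    {f g : 𝓢(Fin N → ℝ, ℂ)} (hf : IsSymmetricFn ⇑f) (hg : IsSymmetricFn ⇑g) :
    (Tᶜ.card : ℝ) * (2 * realInner (prodOp ω (insert l T) f) g
        - ∑ m ∈ Tᶜ, quadForm (prodOp ω (insert l T) * oneBodyOp ω m) f)
      ≤ quadForm (prodOp ω T) g := by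
  rw [isSymmetricFn_iff_permOp] at hf hg
  set Z := ∑ m ∈ Tᶜ, oneBodyOp ω m f with hZ
  have hswap : ∀ a ∈ Tᶜ, permOp (Equiv.swap a l) Z = Z := fun a ha =>
    permOp_sum_compl ω (fun m => by
      rw [Finset.mem_compl] at ha
      rcases eq_or_ne m a with rfl | hma
      · simp [ha, hl]
      rcases eq_or_ne m l with rfl | hml
      · simp [ha, hl]
      rw [Equiv.swap_apply_of_ne_of_ne hma hml]) (hf _)
  have hsum (h : 𝓢(Fin N → ℝ, ℂ)) (hh : ∀ a ∈ Tᶜ, permOp (Equiv.swap a l) h = h) :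
      realInner (prodOp ω T Z) h = Tᶜ.card * realInner (prodOp ω (insert l T) f) h := by
    rw [hZ, map_sum, realInner_sum_left, prodOp_insert' ω hl, ← nsmul_eq_mul]
    exact Finset.sum_eq_card_nsmul fun a ha =>
      realInner_prodOp_mul_oneBodyOp_swap ω (Finset.mem_compl.1 ha) hl (hf _) (hh a ha)
  have hZZ : realInner (prodOp ω (insert l T) f) Z
      = ∑ m ∈ Tᶜ, quadForm (prodOp ω (insert l T) * oneBodyOp ω m) f := by
    rw [hZ, realInner_sum_right]
    refine Finset.sum_congr rfl fun m _ => ?_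
    rw [realInner_prodOp_left]
    rfl
  have hpos := quadForm_prodOp_nonneg ω T (g - Z)
  have e1 : realInner Z (prodOp ω T g) = _ :=
    (realInner_prodOp_left ω T Z g).symm.trans (hsum g fun a _ => hg _)
  have e2 : realInner g (prodOp ω T Z) = _ :=
    (realInner_comm _ _).trans (hsum g fun a _ => hg _)
  have e3 : realInner Z (prodOp ω T Z) = _ :=
    (realInner_prodOp_left ω T Z Z).symm.trans (hsum Z hswap)
  rw [quadForm, map_sub, realInner_sub_left, realInner_sub_right, realInner_sub_right, e1, e2, e3,
    hZZ] at hpos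
  rw [quadForm]
  linarith

lemma quadForm_prodOp_mul_oneBodyOp_eq (ω : ℝ) {T : Finset (Fin N)} {a b : Fin N} (ha : a ∉ T)
    (hb : b ∉ T) {f : 𝓢(Fin N → ℝ, ℂ)} (hf : IsSymmetricFn ⇑f) :
    quadForm (prodOp ω T * oneBodyOp ω a) f = quadForm (prodOp ω T * oneBodyOp ω b) f := by
  rw [isSymmetricFn_iff_permOp] at hf
  rw [quadForm, quadForm, realInner_comm, realInner_comm f]
  exact realInner_prodOp_mul_oneBodyOp_swap ω ha hb (hf _) (hf _)

lemma abs_quadForm_prodOp_mul_pairOp_le (ω : ℝ) {W : 𝓢(ℝ, ℝ)} (hW : ∀ x, W (-x) = W x) {C : ℝ}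
    (hC : ∀ s, |W s| ≤ C) {d : ℝ} (hd : 0 < d) {T : Finset (Fin N)} {l i j : Fin N}
    (hl : l ∉ T) (hij : i ≠ j) {f : 𝓢(Fin N → ℝ, ℂ)} (hf : IsSymmetricFn ⇑f) :
    |quadForm (prodOp ω T * pairOp W i j) f| ≤
      (∫ s, |W s|) ^ 2 * quadForm (prodOp ω T) f
      + (1 / 2) * quadForm (prodOp ω T * oneBodyOp ω l) f
      + (if i ∈ T then ((∫ s, |W s|) + ∫ s, |schwartzDeriv W s|)
          * quadForm (prodOp ω T * oneBodyOp ω l) f else 0)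
      + (if j ∈ T then ((∫ s, |W s|) + ∫ s, |schwartzDeriv W s|)
          * quadForm (prodOp ω T * oneBodyOp ω l) f else 0)
      + (if i ∈ T then if j ∈ T then
          (C + d) * ∑ m ∈ T, quadForm (prodOp ω T * oneBodyOp ω m) f
            + (C + d⁻¹ * ∫ s, schwartzDeriv W s ^ 2)
              * quadForm (prodOp ω T * oneBodyOp ω l) f else 0 else 0) := by
  have hC0 : 0 ≤ C := (abs_nonneg _).trans (hC 0)
  have hI : 0 ≤ ∫ s, |W s| := integral_nonneg fun s => abs_nonneg _
  have hI' : 0 ≤ ∫ s, |schwartzDeriv W s| := integral_nonneg fun s => abs_nonneg _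
  have hK : 0 ≤ d⁻¹ * ∫ s, schwartzDeriv W s ^ 2 :=
    mul_nonneg (by positivity) (integral_nonneg fun s => sq_nonneg _)
  have hQ := quadForm_prodOp_nonneg ω T f
  have hQE := quadForm_prodOp_le_mul_oneBodyOp ω hl f
  have hE := hQ.trans hQE
  have h1 := mul_nonneg (sq_nonneg (∫ s, |W s|)) hQ
  have h2 := mul_nonneg (add_nonneg hI hI') hE
  by_cases hi : i ∈ T <;> by_cases hj : j ∈ T <;> simp only [hi, hj, if_true, if_false]
  · have h := abs_quadForm_prodOp_mul_pairOp_le_of_mem ω hC hd hi hj hij f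
    have h3 := mul_le_mul_of_nonneg_left (Finset.single_le_sum
      (fun m _ => quadForm_prodOp_mul_oneBodyOp_nonneg ω T m f) hi) (add_nonneg hC0 hd.le)
    have h4 := mul_le_mul_of_nonneg_left hQE (add_nonneg hC0 hK)
    linarith
  · have h := abs_quadForm_prodOp_mul_pairOp_le_of_mem_of_notMem ω W hi hj f
    rw [quadForm_prodOp_mul_oneBodyOp_eq ω hj hl hf] at h
    linarith
  · have h := abs_quadForm_prodOp_mul_pairOp_le_of_mem_of_notMem ω W hj hi f
    rw [quadForm_prodOp_mul_oneBodyOp_eq ω hi hl hf, pairOp_comm_of_even hW] at h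
    linarith
  · have h := abs_quadForm_prodOp_mul_pairOp_le_of_notMem ω W hi hj hij f
    rw [quadForm_prodOp_mul_oneBodyOp_eq ω hj hl hf] at h
    linarith

lemma sum_offDiag_ite_le (T : Finset (Fin N)) {a b c : ℝ} (ha : 0 ≤ a) (hb : 0 ≤ b)
    (hc : 0 ≤ c) :
    ∑ p ∈ (Finset.univ : Finset (Fin N)).offDiag, (a + (if p.1 ∈ T then b else 0)
        + (if p.2 ∈ T then b else 0) + (if p.1 ∈ T then if p.2 ∈ T then c else 0 else 0))
      ≤ (N : ℝ) ^ 2 * a + 2 * N * T.card * b + (T.card : ℝ) ^ 2 * c := by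
  refine (Finset.sum_le_sum_of_subset_of_nonneg (Finset.subset_univ _) fun p _ _ => ?_).trans ?_
  · split_ifs <;> positivity
  · refine le_of_eq ?_
    rw [Fintype.sum_prod_type]
    have hχ (r : ℝ) : ∑ i : Fin N, (if i ∈ T then r else 0) = T.card * r := by
      rw [Finset.sum_ite_mem, Finset.univ_inter, Finset.sum_const, nsmul_eq_mul]
    have hχ' (r : ℝ) : ∑ i : Fin N, ∑ _j : Fin N, (if i ∈ T then r else 0) = N * (T.card * r) := by
      rw [Finset.sum_comm, Finset.sum_congr rfl fun _ _ => hχ r, Finset.sum_const,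
        Finset.card_univ, Fintype.card_fin, nsmul_eq_mul]
    have hχχ (r : ℝ) : ∑ i : Fin N, ∑ j : Fin N, (if i ∈ T then if j ∈ T then r else 0 else 0)
        = T.card * (T.card * r) := by
      rw [← hχ, ← hχ]
      exact Finset.sum_congr rfl fun i _ => by split_ifs <;> simp
    simp only [Finset.sum_add_distrib, hχ', hχχ, hχ, Finset.sum_const, Finset.card_univ,
      Fintype.card_fin, nsmul_eq_mul]
    ring

lemma sum_abs_quadForm_prodOp_mul_pairOp_le (ω : ℝ) {W : 𝓢(ℝ, ℝ)} (hW : ∀ x, W (-x) = W x)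
    {C : ℝ} (hC : ∀ s, |W s| ≤ C) {d : ℝ} (hd : 0 < d) {T : Finset (Fin N)} {l : Fin N}
    (hl : l ∉ T) {f : 𝓢(Fin N → ℝ, ℂ)} (hf : IsSymmetricFn ⇑f) :
    ∑ p ∈ Finset.univ.offDiag, |quadForm (prodOp ω T * pairOp W p.1 p.2) f| ≤
      (N : ℝ) ^ 2 * ((∫ s, |W s|) ^ 2 * quadForm (prodOp ω T) f
        + (1 / 2) * quadForm (prodOp ω T * oneBodyOp ω l) f)
      + 2 * N * T.card * (((∫ s, |W s|) + ∫ s, |schwartzDeriv W s|)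
          * quadForm (prodOp ω T * oneBodyOp ω l) f)
      + (T.card : ℝ) ^ 2 * ((C + d) * ∑ m ∈ T, quadForm (prodOp ω T * oneBodyOp ω m) f
            + (C + d⁻¹ * ∫ s, schwartzDeriv W s ^ 2)
              * quadForm (prodOp ω T * oneBodyOp ω l) f) := by
  have hC0 : 0 ≤ C := (abs_nonneg _).trans (hC 0)
  have hI : 0 ≤ ∫ s, |W s| := integral_nonneg fun s => abs_nonneg _
  have hI' : 0 ≤ ∫ s, |schwartzDeriv W s| := integral_nonneg fun s => abs_nonneg _
  have hK : 0 ≤ d⁻¹ * ∫ s, schwartzDeriv W s ^ 2 :=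
    mul_nonneg (by positivity) (integral_nonneg fun s => sq_nonneg _)
  have hQ := quadForm_prodOp_nonneg ω T f
  have hE := quadForm_prodOp_mul_oneBodyOp_nonneg ω T l f
  have hG : 0 ≤ ∑ m ∈ T, quadForm (prodOp ω T * oneBodyOp ω m) f :=
    Finset.sum_nonneg fun m _ => quadForm_prodOp_mul_oneBodyOp_nonneg ω T m f
  exact (Finset.sum_le_sum fun p hp => abs_quadForm_prodOp_mul_pairOp_le ω hW hC hd hl
    (Finset.mem_offDiag.1 hp).2.2 hf).trans
    (sum_offDiag_ite_le T
      (add_nonneg (mul_nonneg (sq_nonneg _) hQ) (mul_nonneg (by norm_num) hE))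
      (mul_nonneg (add_nonneg hI hI') hE)
      (add_nonneg (mul_nonneg (add_nonneg hC0 hd.le) hG) (mul_nonneg (add_nonneg hC0 hK) hE)))

lemma quadForm_mul_hamOp (ω a : ℝ) (W : 𝓢(ℝ, ℝ)) (A : SchwartzOp N) (f : 𝓢(Fin N → ℝ, ℂ)) :
    quadForm (A * hamOp N ω a W) f = ∑ m, quadForm (A * oneBodyOp ω m) f
      + N * a * quadForm A f
      + (2 * N : ℝ)⁻¹ * ∑ p ∈ Finset.univ.offDiag, quadForm (A * pairOp W p.1 p.2) f := by
  rw [hamOp, mul_add, mul_add, Finset.mul_sum, mul_smul_comm, mul_smul_comm, Finset.mul_sum,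
    mul_one, quadForm_add, quadForm_add, quadForm_smul, quadForm_smul, quadForm_sum,
    quadForm_sum]

lemma le_quadForm_prodOp_mul_hamOp (ω : ℝ) {W : 𝓢(ℝ, ℝ)} (hW : ∀ x, W (-x) = W x)
    {C : ℝ} (hC : ∀ s, |W s| ≤ C) {d : ℝ} (hd : 0 < d) {T : Finset (Fin N)} {l : Fin N}
    (hl : l ∉ T) {f : 𝓢(Fin N → ℝ, ℂ)} (hf : IsSymmetricFn ⇑f) :
    (∑ m ∈ T, quadForm (prodOp ω T * oneBodyOp ω m) f)
        * (1 - (T.card : ℝ) ^ 2 / (2 * N) * (C + d))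
      + quadForm (prodOp ω T * oneBodyOp ω l) f * (3 / 4 * N - T.card
        - T.card * ((∫ s, |W s|) + ∫ s, |schwartzDeriv W s|)
        - (T.card : ℝ) ^ 2 / (2 * N) * (C + d⁻¹ * ∫ s, schwartzDeriv W s ^ 2))
      ≤ quadForm (prodOp ω T * hamOp N ω ((∫ s, |W s|) ^ 2) W) f := by
  have hN : (0 : ℝ) < N := Nat.cast_pos.2 (l.pos)
  have hQ := mul_nonneg (sq_nonneg (∫ s, |W s|)) (quadForm_prodOp_nonneg ω T f)
  have hsum : ∑ m, quadForm (prodOp ω T * oneBodyOp ω m) f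
      = ∑ m ∈ T, quadForm (prodOp ω T * oneBodyOp ω m) f
        + (N - T.card) * quadForm (prodOp ω T * oneBodyOp ω l) f := by
    rw [← Finset.sum_add_sum_compl T, Finset.sum_eq_card_nsmul (s := Tᶜ)
      (fun m hm => quadForm_prodOp_mul_oneBodyOp_eq ω (Finset.mem_compl.1 hm) hl hf),
      nsmul_eq_mul, Finset.card_compl, Fintype.card_fin,
      Nat.cast_sub (by simpa using Finset.card_le_univ T)]
  have hpair := sum_abs_quadForm_prodOp_mul_pairOp_le ω hW hC hd hl hf
  have hneg := neg_le_of_abs_le (Finset.abs_sum_le_sum_abs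
    (fun p : Fin N × Fin N => quadForm (prodOp ω T * pairOp W p.1 p.2) f) Finset.univ.offDiag)
  have h := mul_le_mul_of_nonneg_left ((neg_le_neg hpair).trans hneg)
    (inv_nonneg.2 (mul_pos two_pos hN).le)
  rw [quadForm_mul_hamOp, hsum]
  generalize ∑ p ∈ Finset.univ.offDiag, quadForm (prodOp ω T * pairOp W p.1 p.2) f = P at h ⊢
  generalize ∑ m ∈ T, quadForm (prodOp ω T * oneBodyOp ω m) f = G at h ⊢
  generalize quadForm (prodOp ω T * oneBodyOp ω l) f = E at h ⊢
  generalize quadForm (prodOp ω T) f = Q at h hQ ⊢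
  generalize ∫ s, schwartzDeriv W s ^ 2 = J at h ⊢
  generalize ∫ s, |schwartzDeriv W s| = I' at h ⊢
  generalize ∫ s, |W s| = I at h hQ ⊢
  refine le_trans ?_ (add_le_add_right h _)
  have hQ' := mul_nonneg (half_pos hN).le hQ
  rw [← sub_nonneg]
  refine hQ'.trans_eq ?_
  field_simp
  ring

end energy

section induction

variable {N : ℕ}

lemma half_mul_quadForm_oneBodyOp_le_hamOp (ω : ℝ) {W : 𝓢(ℝ, ℝ)} (hW : ∀ x, W (-x) = W x)
    (l : Fin N) {f : 𝓢(Fin N → ℝ, ℂ)} (hf : IsSymmetricFn ⇑f) :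
    N / 2 * quadForm (oneBodyOp ω l) f ≤ quadForm (hamOp N ω ((∫ s, |W s|) ^ 2) W) f := by
  obtain ⟨C, -, hC⟩ := exists_abs_schwartz_le W
  have h := le_quadForm_prodOp_mul_hamOp ω hW hC one_pos (Finset.notMem_empty l) hf
  have hE := quadForm_prodOp_mul_oneBodyOp_nonneg ω ∅ l f
  simp only [prodOp_empty, one_mul, Finset.sum_empty, Finset.card_empty, Nat.cast_zero] at h hE
  norm_num at h
  have := mul_nonneg (Nat.cast_nonneg (α := ℝ) N) hE
  linarith

lemma quarter_sq_mul_quadForm_prodOp_le (ω : ℝ) {V : 𝓢(ℝ, ℝ)} (hV : ∀ x, V (-x) = V x)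
    {C : ℝ} (hC : ∀ s, |V s| ≤ C) {c : ℝˣ} (hc : 1 ≤ (c : ℝ)) (hcN : (c : ℝ) ≤ N)
    {T : Finset (Fin N)} {l l' : Fin N} (hl : l ∉ T) (hl' : l' ∉ insert l T) {t : ℝ}
    (ht : t = T.card + 1)
    (hN : 16 * (t + t * ((∫ s, |V s|) + ∫ s, |schwartzDeriv V s|)
      + t ^ 2 * (C + 1 + ∫ s, schwartzDeriv V s ^ 2)) * c ≤ N)
    {f : 𝓢(Fin N → ℝ, ℂ)} (hf : IsSymmetricFn ⇑f) :
    N ^ 2 / 4 * quadForm (prodOp ω (insert l' (insert l T))) f ≤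
      quadForm (prodOp ω T)
        (hamOp N ω ((∫ s, |V s|) ^ 2) (scaleSchwartz c V) f) := by
  have hc0 : 0 < (c : ℝ) := one_pos.trans_le hc
  have hN0 : (0 : ℝ) < N := hc0.trans_le hcN
  have hcard : ((insert l T).card : ℝ) = t := by
    rw [Finset.card_insert_of_notMem hl, ht]; push_cast; ring
  have ht0 : 1 ≤ t := by rw [ht]; linarith [Nat.cast_nonneg (α := ℝ) T.card]
  have h1 := card_compl_mul_le_quadForm_prodOp ω hl hf
    (hf.hamOp ω ((∫ s, |V s|) ^ 2) (scaleSchwartz c V))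
  have h2 := le_quadForm_prodOp_mul_hamOp ω (scaleSchwartz_neg hV c)
    (abs_scaleSchwartz_le hc0 hC) hc0 hl' hf
  rw [integral_abs_scaleSchwartz hc0, integral_abs_schwartzDeriv_scaleSchwartz hc0,
    integral_schwartzDeriv_scaleSchwartz_sq hc0, hcard] at h2
  have hn : (Tᶜ.card : ℝ) = N - (t - 1) := by
    rw [Finset.card_compl, Fintype.card_fin,
      Nat.cast_sub (by simpa using Finset.card_le_univ T), ht]
    ring
  have hsum : ∑ m ∈ Tᶜ, quadForm (prodOp ω (insert l T) * oneBodyOp ω m) f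
      = quadForm (prodOp ω (insert l T) * oneBodyOp ω l) f
        + (N - t) * quadForm (prodOp ω (insert l T) * oneBodyOp ω l') f := by
    rw [← Finset.add_sum_erase _ _ (Finset.mem_compl.2 hl), ← Finset.compl_insert,
      Finset.sum_eq_card_nsmul fun m hm =>
        quadForm_prodOp_mul_oneBodyOp_eq ω (Finset.mem_compl.1 hm) hl' hf,
      nsmul_eq_mul, Finset.card_compl, Fintype.card_fin,
      Nat.cast_sub (by simpa using Finset.card_le_univ (insert l T)), hcard]
  have hG := Finset.single_le_sum
    (fun m _ => quadForm_prodOp_mul_oneBodyOp_nonneg ω (insert l T) m f)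
    (Finset.mem_insert_self l T)
  have hG0 := quadForm_prodOp_mul_oneBodyOp_nonneg ω (insert l T) l f
  have hE := quadForm_prodOp_mul_oneBodyOp_nonneg ω (insert l T) l' f
  have hH : realInner (prodOp ω (insert l T) f)
        (hamOp N ω ((∫ s, |V s|) ^ 2) (scaleSchwartz c V) f)
      = quadForm (prodOp ω (insert l T)
        * hamOp N ω ((∫ s, |V s|) ^ 2) (scaleSchwartz c V)) f := realInner_prodOp_left ω _ _ _
  rw [hsum, hn, hH] at h1
  rw [prodOp_insert' ω hl']
  have hC0 : 0 ≤ C := (abs_nonneg _).trans (hC 0)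
  have hI : 0 ≤ ∫ s, |V s| := integral_nonneg fun s => abs_nonneg _
  have hI' : 0 ≤ ∫ s, |schwartzDeriv V s| := integral_nonneg fun s => abs_nonneg _
  have hJ : 0 ≤ ∫ s, schwartzDeriv V s ^ 2 := integral_nonneg fun s => sq_nonneg _
  refine le_trans ?_ h1
  clear h1 hsum hH hf hn hcard
  generalize quadForm (prodOp ω (insert l T)
    * hamOp N ω ((∫ s, |V s|) ^ 2) (scaleSchwartz c V)) f = H at *
  generalize ∑ m ∈ insert l T, quadForm (prodOp ω (insert l T) * oneBodyOp ω m) f = G at *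
  generalize quadForm (prodOp ω (insert l T) * oneBodyOp ω l) f = g at *
  generalize quadForm (prodOp ω (insert l T) * oneBodyOp ω l') f = E at *
  generalize ∫ s, schwartzDeriv V s ^ 2 = J at *
  generalize ∫ s, |schwartzDeriv V s| = I' at *
  generalize ∫ s, |V s| = I at *
  generalize (c : ℝ) = b at *
  generalize (N : ℝ) = n at *
  have hb1 : t * I ≤ t * I * b := le_mul_of_one_le_right (by positivity) hc
  have hb2 : t ≤ t * b := le_mul_of_one_le_right (by positivity) hc
  have p1 : 0 ≤ t ^ 2 * J * b := by positivity
  have p2 : 0 ≤ t ^ 2 * C * b := by positivity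
  have p3 : 0 ≤ t ^ 2 * b := by positivity
  have p4 : 0 ≤ t * I * b := by positivity
  have p5 : 0 ≤ t * I' * b := by positivity
  have p6 : 0 ≤ t * b := by positivity
  have hn1 : 1 ≤ n := hc.trans hcN
  have hX : t ^ 2 / (2 * n) * (b * C + b) ≤ 1 / 2 := by
    rw [div_mul_eq_mul_div, div_le_iff₀ (by positivity)]
    linarith
  have hZ : t ^ 2 / (2 * n) * (b * C + b⁻¹ * (b ^ 3 * J)) ≤ t ^ 2 * C * b + t ^ 2 * J * b := by
    rw [show b⁻¹ * (b ^ 3 * J) = b * b * J by field_simp, div_mul_eq_mul_div,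
      div_le_iff₀ (by positivity)]
    have q1 := mul_le_mul_of_nonneg_left hn1 p2
    have q2 := mul_le_mul_of_nonneg_left hcN p1
    have q3 := mul_nonneg p1 hN0.le
    have q4 := mul_nonneg p2 hN0.le
    linarith
  have r1 := mul_le_mul_of_nonneg_left hX (hG0.trans hG)
  have hY : 11 / 16 * n ≤ 3 / 4 * n - t - t * (I + b * I')
      - t ^ 2 / (2 * n) * (b * C + b⁻¹ * (b ^ 3 * J)) := by linarith
  have r2 := mul_le_mul_of_nonneg_left hY hE
  have r3 : 3 / 8 * n * E ≤ 2 * H - (g + (n - t) * E) := by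
    have := mul_nonneg (zero_le_one.trans ht0) hE
    linarith
  have r4 : 15 / 16 * n ≤ n - (t - 1) := by linarith
  have r5 : 0 ≤ n ^ 2 * E := by positivity
  refine le_trans ?_ (mul_le_mul r4 r3 (by positivity) ((by positivity : 0 ≤ 15 / 16 * n).trans r4))
  linarith

lemma exists_forall_mul_rpow_le (K : ℝ) {β : ℝ} (hβ : β < 1) :
    ∃ N₀ : ℕ, ∀ N : ℕ, N₀ ≤ N → K * (N : ℝ) ^ β ≤ N := by
  have h : Filter.Tendsto (fun N : ℕ => (N : ℝ) ^ (1 - β)) Filter.atTop Filter.atTop :=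
    (tendsto_rpow_atTop (sub_pos.2 hβ)).comp tendsto_natCast_atTop_atTop
  obtain ⟨N₀, h₀⟩ := Filter.eventually_atTop.1 (h.eventually_ge_atTop K)
  refine ⟨N₀ + 1, fun N hN => ?_⟩
  have hpos : (0 : ℝ) < N := Nat.cast_pos.2 (by omega)
  calc K * (N : ℝ) ^ β ≤ (N : ℝ) ^ (1 - β) * (N : ℝ) ^ β :=
        mul_le_mul_of_nonneg_right (h₀ N (by omega)) (by positivity)
    _ = N := by rw [← Real.rpow_add hpos, sub_add_cancel, Real.rpow_one]

lemma exists_forall_le_quadForm_hamOp_pow (ω : ℝ) {β : ℝ} (hβ0 : 0 < β) (hβ1 : β < 1)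
    {V : 𝓢(ℝ, ℝ)} (hV : ∀ x, V (-x) = V x) (k : ℕ) :
    ∃ N₀ : ℕ, ∀ N : ℕ, N₀ ≤ N → k ≤ N → ∀ c : ℝˣ, (c : ℝ) = (N : ℝ) ^ β →
      ∀ f : 𝓢(Fin N → ℝ, ℂ), IsSymmetricFn ⇑f →
        ((2 : ℝ) ^ k)⁻¹ * (N : ℝ) ^ k * quadForm (prodOp ω (firstVars N k)) f
          ≤ quadForm (hamOp N ω ((∫ s, |V s|) ^ 2) (scaleSchwartz c V) ^ k) f := by
  induction k using Nat.twoStepInduction with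
  | zero => exact ⟨0, fun N _ _ c _ f _ => by simp [firstVars_zero, prodOp_empty]⟩
  | one =>
    refine ⟨0, fun N _ hN c hc f hf => ?_⟩
    have hc0 : 0 < (c : ℝ) := hc ▸ Real.rpow_pos_of_pos (Nat.cast_pos.2 hN) β
    have h := half_mul_quadForm_oneBodyOp_le_hamOp ω (scaleSchwartz_neg hV c) ⟨0, hN⟩ hf
    rw [integral_abs_scaleSchwartz hc0] at h
    rw [firstVars_succ hN, prodOp_insert ω (notMem_firstVars hN), firstVars_zero, prodOp_empty,
      mul_one, pow_one, pow_one, pow_one]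
    linarith
  | more k ih _ =>
    obtain ⟨N₁, h₁⟩ := ih
    obtain ⟨C, -, hC⟩ := exists_abs_schwartz_le V
    obtain ⟨N₂, h₂⟩ := exists_forall_mul_rpow_le
      (16 * (((k : ℝ) + 1) + ((k : ℝ) + 1) * ((∫ s, |V s|) + ∫ s, |schwartzDeriv V s|)
        + ((k : ℝ) + 1) ^ 2 * (C + 1 + ∫ s, schwartzDeriv V s ^ 2))) hβ1
    refine ⟨max N₁ N₂, fun N hN hkN c hc f hf => ?_⟩
    have hN1 : (1 : ℝ) ≤ N := Nat.one_le_cast.2 (by omega)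
    have hk : k < N := by omega
    have hk1 : k + 1 < N := by omega
    set H := hamOp N ω ((∫ s, |V s|) ^ 2) (scaleSchwartz c V) with hH
    have hstep : (N : ℝ) ^ 2 / 4 * quadForm (prodOp ω (firstVars N (k + 2))) f
        ≤ quadForm (prodOp ω (firstVars N k)) (H f) := by
      rw [firstVars_succ hk1, firstVars_succ hk]
      refine quarter_sq_mul_quadForm_prodOp_le ω hV hC (t := (k : ℝ) + 1)
        (hc ▸ Real.one_le_rpow hN1 hβ0.le) ?_ (notMem_firstVars hk) ?_ ?_ ?_ hf
      · rw [hc]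
        exact (Real.rpow_le_rpow_of_exponent_le hN1 hβ1.le).trans_eq (Real.rpow_one _)
      · rw [← firstVars_succ hk]
        exact notMem_firstVars hk1
      · rw [card_firstVars hk.le]
      · rw [hc]
        exact h₂ N (le_of_max_le_right hN)
    have hpow : quadForm (H ^ (k + 2)) f = quadForm (H ^ k) (H f) := by
      rw [quadForm, quadForm, hH, realInner_hamOp_left, pow_succ, pow_succ',
        Module.End.mul_apply, Module.End.mul_apply]
    rw [hpow]
    refine le_trans ?_ (h₁ N (le_of_max_le_left hN) hk.le c hc (H f) (hf.hamOp _ _ _))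
    have := mul_le_mul_of_nonneg_left hstep
      (by positivity : 0 ≤ ((2 : ℝ) ^ k)⁻¹ * (N : ℝ) ^ k)
    refine le_trans (le_of_eq ?_) this
    rw [pow_add, pow_add, mul_inv]
    ring

end induction

/-- **Energy estimate for the focusing `N`-body Hamiltonian** (Theorem 4.1): with
`α = ‖V‖²_{L¹}`, for every `k ≥ 1` there is `N₀` such that for all `N ≥ max(N₀, k)` and
every symmetric normalized Schwartz `ψ`,
`Re ⟨ψ, (H_N + Nα + N)^k ψ⟩ ≥ 2^{-k} N^k Re ⟨ψ, S₁²⋯S_k² ψ⟩`. -/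
theorem energy_estimate (ω β : ℝ) (hβ0 : 0 < β) (hβ1 : β < 1)
    (V : SchwartzMap ℝ ℝ) (hVeven : ∀ x : ℝ, V (-x) = V x) (k : ℕ) (hk : 1 ≤ k) :
    ∃ N₀ : ℕ, ∀ N : ℕ, N₀ ≤ N → k ≤ N →
      ∀ ψ : SchwartzMap (Fin N → ℝ) ℂ, IsSymmetricFn ⇑ψ →
        (∫ x : Fin N → ℝ, ‖ψ x‖ ^ 2) = 1 →
        ((2 : ℝ) ^ k)⁻¹ * (N : ℝ) ^ k * reInner ⇑ψ (Sprod ω N k ⇑ψ)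
          ≤ reInner ⇑ψ
            ((HamPlus ω β ⇑V N ((N : ℝ) * (∫ x : ℝ, |V x|) ^ 2 + (N : ℝ)))^[k] ⇑ψ) := by
  obtain ⟨N₀, h₀⟩ := exists_forall_le_quadForm_hamOp_pow ω hβ0 hβ1 hVeven k
  refine ⟨N₀, fun N hN hkN ψ hψ _ => ?_⟩
  have hpos : (N : ℝ) ^ β ≠ 0 := (Real.rpow_pos_of_pos (Nat.cast_pos.2 (by omega)) β).ne'
  rw [Sprod_coe ω hkN, iterate_HamPlus_coe ω β _ hVeven (Units.val_mk0 hpos),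
    reInner_eq_realInner, reInner_eq_realInner]
  exact h₀ N hN hkN (Units.mk0 _ hpos) (Units.val_mk0 hpos) ψ hψ

end
end
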